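/- Let H ∈ (0, 1/2), ε ∈ (0, H), H' ∈ (2H, 1), T > 0, and set R_u = u^{−2/H'} and δ_u = (ln u)²/u². Let Y_H(t, s) = B_H(t) − B_H(s). For every integer l with 1 ≤ l ≤ ⌊T/R_u⌋ and every integer k with 1 ≤ k ≤ ⌊δ_u/R_u + 1⌋, define the rectangle J_{k,l} = [1 + (l − k) R_u, 1 + (l − k + 1) R_u] × [(l − 1) R_u, l R_u] and u_{k−} = u / (1 − (H − ε)(k − 2) R_u). Then for all sufficiently large u and all such k, l, P( max_{(t,s) ∈ J_{k,l}} Y_H(t, s) > u ) ≤ (1/2 + ε)^{1/H} · 𝓗_{2H}² · u_{k−}^{2/H} · R_u² · Ψ(u_{k−}). -/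

import Mathlib

open MeasureTheory ProbabilityTheory Real Filter Set

/-- Tail `Ψ(u) = P(N > u)` of a standard normal random variable. -/
noncomputable def stdNormalTail (u : ℝ) : ℝ :=
  ((ProbabilityTheory.gaussianReal 0 1) (Set.Ioi u)).toReal

/-- Supremum of `Y_H(t,s) = B_H(t) - B_H(s)` over the rectangle `[t₁,t₂] × [s₁,s₂]`. -/
noncomputable def supYOnRect {Ω : Type*} (B : ℝ → Ω → ℝ) (t₁ t₂ s₁ s₂ : ℝ) (ω : Ω) : ℝ :=
  ⨆ (t : Set.Icc t₁ t₂) (s : Set.Icc s₁ s₂), (B (t:ℝ) ω - B (s:ℝ) ω)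

/-- A linear space of centred Gaussian random variables. -/
structure IsGaussianSpace {Ω : Type*} [MeasurableSpace Ω] (S : Submodule ℝ (Ω → ℝ))
    (μ : Measure Ω) : Prop where
  measurable : ∀ f ∈ S, Measurable f
  exists_map_eq : ∀ f ∈ S, ∃ v : NNReal, μ.map f = gaussianReal 0 v

namespace IsGaussianSpace

variable {Ω Ω' : Type*} [MeasurableSpace Ω] [MeasurableSpace Ω'] {μ : Measure Ω} {ν : Measure Ω'}
  {S : Submodule ℝ (Ω → ℝ)} {S' : Submodule ℝ (Ω' → ℝ)} {f g : Ω → ℝ}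

lemma memLp_two (hS : IsGaussianSpace S μ) (hf : f ∈ S) : MemLp f 2 μ := by
  obtain ⟨v, hv⟩ := hS.exists_map_eq f hf
  have h : MemLp id 2 (μ.map f) := by
    rw [hv]; exact memLp_id_gaussianReal 2
  exact (memLp_map_measure_iff aestronglyMeasurable_id (hS.measurable f hf).aemeasurable).1 h

lemma integrable_mul (hS : IsGaussianSpace S μ) (hf : f ∈ S) (hg : g ∈ S) :
    Integrable (fun ω => f ω * g ω) μ :=
  (hS.memLp_two hf).integrable_mul (hS.memLp_two hg)

lemma map_eq (hS : IsGaussianSpace S μ) (hf : f ∈ S) :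
    μ.map f = gaussianReal 0 (∫ ω, f ω * f ω ∂μ).toNNReal := by
  obtain ⟨v, hv⟩ := hS.exists_map_eq f hf
  have hm : Measurable f := hS.measurable f hf
  have h1 : ∫ ω, f ω * f ω ∂μ = ∫ x, x * x ∂(gaussianReal 0 v) := by
    rw [← hv, integral_map hm.aemeasurable]
    exact (measurable_id.mul measurable_id).aestronglyMeasurable
  have h2 : ∫ x, x * x ∂(gaussianReal 0 v) = v := by
    have := variance_fun_id_gaussianReal (μ := 0) (v := v)
    rw [variance_eq_sub (by exact memLp_id_gaussianReal 2)] at this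
    simpa [integral_id_gaussianReal, pow_two] using this
  rw [h1, h2, hv, Real.toNNReal_coe]

lemma comp_strongDual {ι : Type*} [Fintype ι] [DecidableEq ι] (hS : IsGaussianSpace S μ)
    (L : StrongDual ℝ (ι → ℝ)) {Z : ι → Ω → ℝ} (hZ : ∀ i, Z i ∈ S) :
    ((L : (ι → ℝ) → ℝ) ∘ fun ω i => Z i ω) ∈ S ∧
      ∫ ω, ((L : (ι → ℝ) → ℝ) ∘ fun ω i => Z i ω) ω * ((L : (ι → ℝ) → ℝ) ∘ fun ω i => Z i ω) ω ∂μ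
        = ∑ i, ∑ j, L (Pi.single i 1) * L (Pi.single j 1) * ∫ ω, Z i ω * Z j ω ∂μ := by
  have e : ((L : (ι → ℝ) → ℝ) ∘ fun ω i => Z i ω) = ∑ i, L (Pi.single i 1) • Z i := by
    ext ω
    simp only [Function.comp, Finset.sum_apply, Pi.smul_apply, smul_eq_mul]
    conv_lhs => rw [show (fun i => Z i ω) = ∑ i, Z i ω • Pi.single i (1:ℝ) from by
      ext j; simp [Finset.sum_apply, Pi.single_apply]]
    simp [map_sum, mul_comm]
  refine ⟨e ▸ Submodule.sum_mem _ fun i _ => S.smul_mem _ (hZ i), ?_⟩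
  rw [e]
  simp only [Finset.sum_apply, Pi.smul_apply, smul_eq_mul, Finset.sum_mul_sum]
  have hi : ∀ i j, Integrable
      (fun ω => L (Pi.single i 1) * Z i ω * (L (Pi.single j 1) * Z j ω)) μ := fun i j =>
    ((hS.integrable_mul (hZ i) (hZ j)).const_mul
      (L (Pi.single i 1) * L (Pi.single j 1))).congr (ae_of_all _ fun ω => by ring)
  rw [integral_finsetSum _ fun i _ => integrable_finsetSum _ fun j _ => hi i j]
  refine Finset.sum_congr rfl fun i _ => ?_
  rw [integral_finsetSum _ fun j _ => hi i j]
  refine Finset.sum_congr rfl fun j _ => ?_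
  rw [← integral_const_mul]
  congr 1; ext ω; ring

/-- Finite Gaussian families with the same second moments have the same law. -/
lemma map_pi_eq {ι : Type*} [Fintype ι] [IsProbabilityMeasure μ] [IsProbabilityMeasure ν]
    (hS : IsGaussianSpace S μ) (hS' : IsGaussianSpace S' ν)
    {X : ι → Ω → ℝ} {Y : ι → Ω' → ℝ} (hX : ∀ i, X i ∈ S) (hY : ∀ i, Y i ∈ S')
    (h : ∀ i j, ∫ ω, X i ω * X j ω ∂μ = ∫ ω, Y i ω * Y j ω ∂ν) :
    μ.map (fun ω i => X i ω) = ν.map (fun ω i => Y i ω) := by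
  classical
  have mX : Measurable (fun ω i => X i ω) := measurable_pi_lambda _ fun i => hS.measurable _ (hX i)
  have mY : Measurable (fun ω i => Y i ω) := measurable_pi_lambda _ fun i => hS'.measurable _ (hY i)
  have := Measure.isProbabilityMeasure_map (μ := μ) mX.aemeasurable
  have := Measure.isProbabilityMeasure_map (μ := ν) mY.aemeasurable
  refine Measure.ext_of_charFunDual (funext fun L => ?_)
  rw [charFunDual_eq_charFun_map_one, charFunDual_eq_charFun_map_one,
    Measure.map_map (by fun_prop) mX, Measure.map_map (by fun_prop) mY]
  obtain ⟨hX1, hX2⟩ := hS.comp_strongDual L hX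
  obtain ⟨hY1, hY2⟩ := hS'.comp_strongDual L hY
  rw [hS.map_eq hX1, hS'.map_eq hY1, hX2, hY2]
  simp only [h]

lemma lintegral_comp_eq {ι : Type*} [Fintype ι] [IsProbabilityMeasure μ] [IsProbabilityMeasure ν]
    (hS : IsGaussianSpace S μ) (hS' : IsGaussianSpace S' ν)
    {X : ι → Ω → ℝ} {Y : ι → Ω' → ℝ} (hX : ∀ i, X i ∈ S) (hY : ∀ i, Y i ∈ S')
    (h : ∀ i j, ∫ ω, X i ω * X j ω ∂μ = ∫ ω, Y i ω * Y j ω ∂ν)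
    {F : (ι → ℝ) → ENNReal} (hF : Measurable F) :
    ∫⁻ ω, F (fun i => X i ω) ∂μ = ∫⁻ ω, F (fun i => Y i ω) ∂ν := by
  have mX : Measurable (fun ω i => X i ω) := measurable_pi_lambda _ fun i => hS.measurable _ (hX i)
  have mY : Measurable (fun ω i => Y i ω) := measurable_pi_lambda _ fun i => hS'.measurable _ (hY i)
  rw [← lintegral_map hF mX, ← lintegral_map hF mY, hS.map_pi_eq hS' hX hY h]

lemma integral_eq_zero (hS : IsGaussianSpace S μ) (hf : f ∈ S) : ∫ ω, f ω ∂μ = 0 := by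
  have hm : Measurable f := hS.measurable f hf
  have := integral_map (μ := μ) hm.aemeasurable (f := fun x : ℝ => x) (by fun_prop)
  rw [← this, hS.map_eq hf, integral_id_gaussianReal]

/-- The sums `f ∘ fst + g ∘ snd` form a Gaussian space for the product measure. -/
lemma prod [IsProbabilityMeasure μ] [IsProbabilityMeasure ν]
    (hS : IsGaussianSpace S μ) (hS' : IsGaussianSpace S' ν) :
    IsGaussianSpace (S.map (LinearMap.funLeft ℝ ℝ (Prod.fst : Ω × Ω' → Ω)) ⊔
      S'.map (LinearMap.funLeft ℝ ℝ (Prod.snd : Ω × Ω' → Ω'))) (μ.prod ν) := by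
  have key : ∀ h ∈ (S.map (LinearMap.funLeft ℝ ℝ (Prod.fst : Ω × Ω' → Ω)) ⊔
      S'.map (LinearMap.funLeft ℝ ℝ (Prod.snd : Ω × Ω' → Ω'))),
      ∃ f ∈ S, ∃ g ∈ S', h = (fun p => f p.1) + fun p => g p.2 := by
    intro h hh
    obtain ⟨a, ha, b, hb, rfl⟩ := Submodule.mem_sup.1 hh
    obtain ⟨f, hf, rfl⟩ := Submodule.mem_map.1 ha
    obtain ⟨g, hg, rfl⟩ := Submodule.mem_map.1 hb
    exact ⟨f, hf, g, hg, rfl⟩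
  refine ⟨fun h hh => ?_, fun h hh => ?_⟩
  · obtain ⟨f, hf, g, hg, rfl⟩ := key h hh
    exact ((hS.measurable f hf).comp measurable_fst).add ((hS'.measurable g hg).comp measurable_snd)
  · obtain ⟨f, hf, g, hg, rfl⟩ := key h hh
    have mf := hS.measurable f hf
    have mg := hS'.measurable g hg
    refine ⟨(∫ ω, f ω * f ω ∂μ).toNNReal + (∫ ω, g ω * g ω ∂ν).toNNReal,
      (gaussianReal_add_gaussianReal_of_indepFun (m₁ := 0) (m₂ := 0) (indepFun_prod mf mg)
      ?_ ?_).trans (by rw [add_zero])⟩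
    · rw [← hS.map_eq hf]
      change (μ.prod ν).map (f ∘ Prod.fst) = _
      rw [← Measure.map_map mf measurable_fst]
      simp [Measure.map_fst_prod]
    · rw [← hS'.map_eq hg]
      change (μ.prod ν).map (g ∘ Prod.snd) = _
      rw [← Measure.map_map mg measurable_snd]
      simp [Measure.map_snd_prod]

lemma add_mem_prod {α β : Type*} {S : Submodule ℝ (α → ℝ)} {S' : Submodule ℝ (β → ℝ)}
    {f : α → ℝ} {g : β → ℝ} (hf : f ∈ S) (hg : g ∈ S') :
    (fun p : α × β => f p.1 + g p.2) ∈ S.map (LinearMap.funLeft ℝ ℝ (Prod.fst : α × β → α)) ⊔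
      S'.map (LinearMap.funLeft ℝ ℝ (Prod.snd : α × β → β)) :=
  Submodule.add_mem_sup (Submodule.mem_map_of_mem (f := LinearMap.funLeft ℝ ℝ Prod.fst) hf)
    (Submodule.mem_map_of_mem (f := LinearMap.funLeft ℝ ℝ Prod.snd) hg)

lemma integral_prod_mul_eq [IsProbabilityMeasure μ] [IsProbabilityMeasure ν]
    (hS : IsGaussianSpace S μ) (hS' : IsGaussianSpace S' ν) {f f' : Ω → ℝ} {g g' : Ω' → ℝ}
    (hf : f ∈ S) (hf' : f' ∈ S) (hg : g ∈ S') (hg' : g' ∈ S') :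
    ∫ p, (f p.1 + g p.2) * (f' p.1 + g' p.2) ∂(μ.prod ν) =
      ∫ ω, f ω * f' ω ∂μ + ∫ ω, g ω * g' ω ∂ν := by
  have i1 : Integrable (fun p : Ω × Ω' => f p.1 * f' p.1) (μ.prod ν) :=
    (hS.integrable_mul hf hf').comp_fst ν
  have i2 : Integrable (fun p : Ω × Ω' => g p.2 * g' p.2) (μ.prod ν) :=
    (hS'.integrable_mul hg hg').comp_snd μ
  have j1 : Integrable (fun p : Ω × Ω' => f p.1 * g' p.2) (μ.prod ν) :=
    ((hS.memLp_two hf).integrable (by norm_num)).mul_prod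
      ((hS'.memLp_two hg').integrable (by norm_num))
  have j2 : Integrable (fun p : Ω × Ω' => f' p.1 * g p.2) (μ.prod ν) :=
    ((hS.memLp_two hf').integrable (by norm_num)).mul_prod
      ((hS'.memLp_two hg).integrable (by norm_num))
  have e : (fun p : Ω × Ω' => (f p.1 + g p.2) * (f' p.1 + g' p.2)) =
      fun p => (f p.1 * f' p.1 + g p.2 * g' p.2) + (f p.1 * g' p.2 + f' p.1 * g p.2) := by
    ext p; ring
  rw [e]
  refine (integral_add (i1.add i2) (j1.add j2)).trans ?_
  refine (congrArg₂ _ (integral_add i1 i2) (integral_add j1 j2)).trans ?_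
  rw [integral_prod_mul f g', integral_prod_mul f' g, hS.integral_eq_zero hf,
    hS.integral_eq_zero hf', integral_fun_fst (fun ω => f ω * f' ω),
    integral_fun_snd (fun ω => g ω * g' ω)]
  simp

lemma integral_add_mul (hS : IsGaussianSpace S μ) {f f' g : Ω → ℝ} (hf : f ∈ S) (hf' : f' ∈ S)
    (hg : g ∈ S) : ∫ ω, (f ω + f' ω) * g ω ∂μ = ∫ ω, f ω * g ω ∂μ + ∫ ω, f' ω * g ω ∂μ := by
  rw [← integral_add (hS.integrable_mul hf hg) (hS.integrable_mul hf' hg)]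
  congr 1; ext ω; ring

lemma integral_mul_add (hS : IsGaussianSpace S μ) {f f' g : Ω → ℝ} (hf : f ∈ S) (hf' : f' ∈ S)
    (hg : g ∈ S) : ∫ ω, g ω * (f ω + f' ω) ∂μ = ∫ ω, g ω * f ω ∂μ + ∫ ω, g ω * f' ω ∂μ := by
  simpa only [mul_comm] using hS.integral_add_mul hf hf' hg

lemma integral_sub_mul (hS : IsGaussianSpace S μ) {f f' g : Ω → ℝ} (hf : f ∈ S) (hf' : f' ∈ S)
    (hg : g ∈ S) : ∫ ω, (f ω - f' ω) * g ω ∂μ = ∫ ω, f ω * g ω ∂μ - ∫ ω, f' ω * g ω ∂μ := by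
  rw [← integral_sub (hS.integrable_mul hf hg) (hS.integrable_mul hf' hg)]
  congr 1; ext ω; ring

lemma integral_mul_sub (hS : IsGaussianSpace S μ) {f f' g : Ω → ℝ} (hf : f ∈ S) (hf' : f' ∈ S)
    (hg : g ∈ S) : ∫ ω, g ω * (f ω - f' ω) ∂μ = ∫ ω, g ω * f ω ∂μ - ∫ ω, g ω * f' ω ∂μ := by
  simpa only [mul_comm] using hS.integral_sub_mul hf hf' hg

end IsGaussianSpace

/-- Exponential of the maximum of a finite family, as an extended nonnegative real. -/
noncomputable def expMax {κ : Type*} (x : κ → ℝ) : ENNReal := ENNReal.ofReal (exp (⨆ k, x k))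

section ExpMax

variable {κ κ' : Type*}

lemma measurable_expMax [Countable κ] : Measurable (expMax : (κ → ℝ) → ENNReal) :=
  (measurable_exp.comp (Measurable.iSup fun k => measurable_pi_apply k)).ennreal_ofReal

variable [Finite κ] [Finite κ']

lemma expMax_mono {x y : κ → ℝ} (h : ∀ k, x k ≤ y k) : expMax x ≤ expMax y :=
  ENNReal.ofReal_le_ofReal (exp_le_exp.2 (ciSup_mono (Finite.bddAbove_range y) h))

variable [Nonempty κ] [Nonempty κ']

lemma expMax_add_const (x : κ → ℝ) (a : ℝ) :
    expMax (fun k => x k + a) = expMax x * ENNReal.ofReal (exp a) := by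
  rw [expMax, expMax, ← ENNReal.ofReal_mul (exp_pos _).le, ← exp_add]
  congr 2
  exact (ciSup_add (Finite.bddAbove_range x) a).symm

lemma ciSup_prod_add (x : κ → ℝ) (y : κ' → ℝ) :
    ⨆ k : κ × κ', (x k.1 + y k.2) = (⨆ k, x k) + ⨆ k, y k := by
  refine le_antisymm (ciSup_le fun k => add_le_add (le_ciSup (Finite.bddAbove_range x) _)
    (le_ciSup (Finite.bddAbove_range y) _)) ?_
  obtain ⟨i, hi⟩ := exists_eq_ciSup_of_finite (f := x)
  obtain ⟨j, hj⟩ := exists_eq_ciSup_of_finite (f := y)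
  rw [← hi, ← hj]
  exact le_ciSup (f := fun k : κ × κ' => x k.1 + y k.2) (Finite.bddAbove_range _) (i, j)

lemma expMax_prod_add (x : κ → ℝ) (y : κ' → ℝ) :
    expMax (fun k : κ × κ' => x k.1 + y k.2) = expMax x * expMax y := by
  rw [expMax, ciSup_prod_add, exp_add, ENNReal.ofReal_mul (exp_pos _).le, expMax, expMax]

lemma two_mul_expMax_le (x z : κ → ℝ) :
    2 * expMax x ≤ expMax (fun k => x k + z k) + expMax (fun k => x k - z k) := by
  obtain ⟨i, hi⟩ := exists_eq_ciSup_of_finite (f := x)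
  have h1 : x i + z i ≤ ⨆ k, (x k + z k) :=
    le_ciSup (f := fun k => x k + z k) (Finite.bddAbove_range _) i
  have h2 : x i - z i ≤ ⨆ k, (x k - z k) :=
    le_ciSup (f := fun k => x k - z k) (Finite.bddAbove_range _) i
  rw [expMax, expMax, expMax, ← ENNReal.ofReal_add (exp_pos _).le (exp_pos _).le,
    ← ENNReal.ofReal_ofNat 2, ← ENNReal.ofReal_mul (by norm_num), ← hi]
  refine ENNReal.ofReal_le_ofReal ?_
  have e1 := exp_le_exp.2 h1
  have e2 := exp_le_exp.2 h2
  have hp := exp_pos (x i)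
  have hq := add_one_le_exp (z i)
  have hq' := add_one_le_exp (-z i)
  rw [exp_add] at e1
  rw [sub_eq_add_neg, exp_add] at e2
  nlinarith

end ExpMax

namespace IsGaussianSpace

variable {Ω Ω' : Type*} [MeasurableSpace Ω] [MeasurableSpace Ω'] {μ : Measure Ω} {ν : Measure Ω'}
  {S : Submodule ℝ (Ω → ℝ)} {S' : Submodule ℝ (Ω' → ℝ)}
  {κ κ' : Type*} [Fintype κ] [Fintype κ']

lemma lintegral_expMax_congr [IsProbabilityMeasure μ] [IsProbabilityMeasure ν]
    (hS : IsGaussianSpace S μ) (hS' : IsGaussianSpace S' ν)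
    {X : κ → Ω → ℝ} {Y : κ → Ω' → ℝ} (hX : ∀ i, X i ∈ S) (hY : ∀ i, Y i ∈ S')
    (h : ∀ i j, ∫ ω, X i ω * X j ω ∂μ = ∫ ω, Y i ω * Y j ω ∂ν) (p : κ → ℝ) :
    ∫⁻ ω, expMax (fun k => p k + X k ω) ∂μ = ∫⁻ ω, expMax (fun k => p k + Y k ω) ∂ν :=
  hS.lintegral_comp_eq hS' hX hY h (F := fun x => expMax (fun k => p k + x k))
    (measurable_expMax.comp (by fun_prop))

lemma measurable_expMax_comp (hS : IsGaussianSpace S μ) {X : κ → Ω → ℝ} (hX : ∀ i, X i ∈ S)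
    (p : κ → ℝ) : Measurable fun ω => expMax (fun k => p k + X k ω) :=
  measurable_expMax.comp
    (measurable_pi_lambda _ fun k => (hS.measurable _ (hX k)).const_add (p k))

variable [Nonempty κ] [Nonempty κ']

/-- Adding an uncorrelated family increases the expected exponential of the maximum. -/
lemma lintegral_expMax_le_add [IsProbabilityMeasure μ] (hS : IsGaussianSpace S μ)
    {X Z : κ → Ω → ℝ} (hX : ∀ i, X i ∈ S) (hZ : ∀ i, Z i ∈ S)
    (h : ∀ i j, ∫ ω, X i ω * Z j ω ∂μ = 0) (p : κ → ℝ) :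
    ∫⁻ ω, expMax (fun k => p k + X k ω) ∂μ ≤
      ∫⁻ ω, expMax (fun k => p k + (X k ω + Z k ω)) ∂μ := by
  have h' : ∀ i j, ∫ ω, Z i ω * X j ω ∂μ = 0 := fun i j => by
    simpa only [mul_comm] using h j i
  have hadd : ∀ i, (fun ω => X i ω + Z i ω) ∈ S := fun i => S.add_mem (hX i) (hZ i)
  have hsub : ∀ i, (fun ω => X i ω - Z i ω) ∈ S := fun i => S.sub_mem (hX i) (hZ i)
  have e := hS.lintegral_expMax_congr hS hadd hsub (fun i j => by
    rw [hS.integral_add_mul (hX i) (hZ i) (hadd j), hS.integral_sub_mul (hX i) (hZ i) (hsub j),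
      hS.integral_mul_add (hX j) (hZ j) (hX i), hS.integral_mul_add (hX j) (hZ j) (hZ i),
      hS.integral_mul_sub (hX j) (hZ j) (hX i), hS.integral_mul_sub (hX j) (hZ j) (hZ i),
      h i j, h' i j]
    ring) p
  have m1 : Measurable fun ω => expMax (fun k => p k + (X k ω + Z k ω)) :=
    hS.measurable_expMax_comp hadd p
  have hle : 2 * ∫⁻ ω, expMax (fun k => p k + X k ω) ∂μ ≤
      2 * ∫⁻ ω, expMax (fun k => p k + (X k ω + Z k ω)) ∂μ := by
    rw [two_mul (∫⁻ ω, expMax (fun k => p k + (X k ω + Z k ω)) ∂μ)]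
    nth_rewrite 2 [e]
    rw [← lintegral_add_left m1, ← lintegral_const_mul _ (hS.measurable_expMax_comp hX p)]
    refine lintegral_mono fun ω => ?_
    have := two_mul_expMax_le (fun k => p k + X k ω) (fun k => Z k ω)
    simpa only [add_assoc, add_sub_assoc] using this
  exact (ENNReal.mul_le_mul_iff_right (by norm_num) (by norm_num)).1 hle

/-- For uncorrelated families the expected exponential of the maximum over pairs factorizes. -/
lemma lintegral_expMax_prod [IsProbabilityMeasure μ] (hS : IsGaussianSpace S μ)
    {U : κ → Ω → ℝ} {W : κ' → Ω → ℝ} (hU : ∀ i, U i ∈ S) (hW : ∀ i, W i ∈ S)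
    (h : ∀ i j, ∫ ω, U i ω * W j ω ∂μ = 0) (p : κ → ℝ) (q : κ' → ℝ) :
    ∫⁻ ω, expMax (fun k : κ × κ' => (p k.1 + U k.1 ω) + (q k.2 + W k.2 ω)) ∂μ =
      (∫⁻ ω, expMax (fun k => p k + U k ω) ∂μ) * ∫⁻ ω, expMax (fun k => q k + W k ω) ∂μ := by
  have h' : ∀ i j, ∫ ω, W i ω * U j ω ∂μ = 0 := fun i j => by
    simpa only [mul_comm] using h j i
  have e := hS.lintegral_expMax_congr (hS.prod hS) (κ := κ × κ')
    (X := fun k ω => U k.1 ω + W k.2 ω) (Y := fun k ω => U k.1 ω.1 + W k.2 ω.2)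
    (fun k => S.add_mem (hU k.1) (hW k.2)) (fun k => add_mem_prod (hU k.1) (hW k.2))
    (fun i j => by
      have hj : (fun ω => U j.1 ω + W j.2 ω) ∈ S := S.add_mem (hU j.1) (hW j.2)
      rw [hS.integral_prod_mul_eq hS (hU _) (hU _) (hW _) (hW _),
        hS.integral_add_mul (hU i.1) (hW i.2) hj, hS.integral_mul_add (hU j.1) (hW j.2) (hU i.1),
        hS.integral_mul_add (hU j.1) (hW j.2) (hW i.2), h, h']
      ring) (fun k => p k.1 + q k.2)
  simp only [fun k : κ × κ' => fun ω : Ω × Ω => add_add_add_comm (p k.1) (q k.2) (U k.1 ω.1)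
    (W k.2 ω.2), fun ω : Ω × Ω => expMax_prod_add (fun k => p k + U k ω.1)
      (fun k => q k + W k ω.2)] at e
  simp only [fun k : κ × κ' => fun ω : Ω => add_add_add_comm (p k.1) (U k.1 ω) (q k.2) (W k.2 ω)]
  rw [e]
  exact lintegral_prod_mul (hS.measurable_expMax_comp hU p).aemeasurable
    (hS.measurable_expMax_comp hW q).aemeasurable

end IsGaussianSpace

section Noise

variable {κ : Type*} [Fintype κ]

/-- The linear functionals of a vector of independent standard normal variables. -/
lemma isGaussianSpace_pi : IsGaussianSpace
    (LinearMap.range (Fintype.linearCombination ℝ (fun k (ξ : κ → ℝ) => ξ k)))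
    (Measure.pi fun _ : κ => gaussianReal 0 1) := by
  refine ⟨fun f hf => ?_, fun f hf => ?_⟩ <;> obtain ⟨c, rfl⟩ := hf
  · rw [show ((Fintype.linearCombination ℝ (fun k (ξ : κ → ℝ) => ξ k)) c) =
        fun ξ : κ → ℝ => ∑ k, c k * ξ k by ext ξ; simp [Fintype.linearCombination_apply]]
    fun_prop
  · have hind : iIndepFun (fun k (ξ : κ → ℝ) => c k * ξ k)
        (Measure.pi fun _ : κ => gaussianReal 0 1) :=
      iIndepFun_pi (X := fun k x => c k * x) fun k => by fun_prop
    have hlaw : ∀ k, HasGaussianLaw (fun ξ : κ → ℝ => ξ k)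
        (Measure.pi fun _ : κ => gaussianReal 0 1) := fun k => by
      refine ⟨?_⟩
      have := (measurePreserving_eval (fun _ : κ => gaussianReal 0 1) k).map_eq
      rw [show (fun ξ : κ → ℝ => ξ k) = Function.eval k from rfl, this]; infer_instance
    have hlaw' : ∀ k, HasGaussianLaw (fun ξ : κ → ℝ => c k * ξ k)
        (Measure.pi fun _ : κ => gaussianReal 0 1) := fun k => 
      (hlaw k).map_fun (c k • ContinuousLinearMap.id ℝ ℝ)
    have h := hind.hasGaussianLaw_fun_sum hlaw'
    have e : ((Fintype.linearCombination ℝ (fun k (ξ : κ → ℝ) => ξ k)) c) =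
        fun ξ : κ → ℝ => ∑ k, c k * ξ k := by
      ext ξ; simp [Fintype.linearCombination_apply]
    rw [e]
    suffices h0 : ∫ ξ : κ → ℝ, ∑ k, c k * ξ k ∂(Measure.pi fun _ => gaussianReal 0 1) = 0 from
      ⟨_, h.map_eq_gaussianReal.trans (congrArg (gaussianReal · _) h0)⟩
    rw [integral_finsetSum _ fun k _ => (hlaw' k).memLp_two.integrable (by norm_num)]
    refine Finset.sum_eq_zero fun k _ => ?_
    rw [integral_const_mul, integral_comp_eval (μ := fun _ : κ => gaussianReal 0 1)
      (f := fun x => x) (by fun_prop), integral_id_gaussianReal, mul_zero]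

lemma sum_mul_mem_range_linearCombination (c : κ → ℝ) : (fun ξ : κ → ℝ => ∑ k, c k * ξ k) ∈
    LinearMap.range (Fintype.linearCombination ℝ (fun k (ξ : κ → ℝ) => ξ k)) :=
  ⟨c, by ext ξ; simp [Fintype.linearCombination_apply]⟩

lemma integral_sum_mul_sum_pi (c c' : κ → ℝ) :
    ∫ ξ : κ → ℝ, (∑ k, c k * ξ k) * (∑ k, c' k * ξ k) ∂(Measure.pi fun _ => gaussianReal 0 1) =
      ∑ k, c k * c' k := by
  classical
  have hmem : ∀ k : κ, (fun ξ : κ → ℝ => ξ k) ∈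
      LinearMap.range (Fintype.linearCombination ℝ (fun k (ξ : κ → ℝ) => ξ k)) := fun k => by
    convert sum_mul_mem_range_linearCombination (Pi.single k (1:ℝ)) using 1
    ext ξ
    simp [Pi.single_apply]
  have hmulint : ∀ i j : κ, Integrable (fun ξ : κ → ℝ => ξ i * ξ j)
      (Measure.pi fun _ => gaussianReal 0 1) := fun i j =>
    isGaussianSpace_pi.integrable_mul (hmem i) (hmem j)
  have hval : ∀ i j : κ, ∫ ξ : κ → ℝ, ξ i * ξ j ∂(Measure.pi fun _ => gaussianReal 0 1) =
      if i = j then 1 else 0 := fun i j => by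
    split_ifs with h
    · subst h
      rw [integral_comp_eval (μ := fun _ : κ => gaussianReal 0 1) (f := fun x => x * x)
        (by fun_prop)]
      have := variance_fun_id_gaussianReal (μ := 0) (v := 1)
      rw [variance_eq_sub (by exact memLp_id_gaussianReal 2)] at this
      simpa [integral_id_gaussianReal, pow_two] using this
    · have hind : iIndepFun (fun k (ξ : κ → ℝ) => ξ k) (Measure.pi fun _ => gaussianReal 0 1) :=
        iIndepFun_pi (X := fun _ x => x) fun k => by fun_prop
      have := (hind.indepFun h).integral_mul_eq_mul_integral
        (measurable_pi_apply i).aestronglyMeasurable (measurable_pi_apply j).aestronglyMeasurable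
      refine Eq.trans this ?_
      rw [isGaussianSpace_pi.integral_eq_zero (hmem i), zero_mul]
  simp only [Finset.sum_mul_sum]
  have hmulint' : ∀ i j : κ, Integrable (fun ξ : κ → ℝ => c i * ξ i * (c' j * ξ j))
      (Measure.pi fun _ => gaussianReal 0 1) := fun i j =>
    ((hmulint i j).const_mul (c i * c' j)).congr (ae_of_all _ fun ω => by ring)
  rw [integral_finsetSum _ fun i _ => integrable_finsetSum _ fun j _ => hmulint' i j]
  refine Finset.sum_congr rfl fun i _ => ?_
  rw [integral_finsetSum _ fun j _ => hmulint' i j]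
  have : ∀ j, ∫ ξ : κ → ℝ, c i * ξ i * (c' j * ξ j) ∂(Measure.pi fun _ => gaussianReal 0 1) =
      c i * c' j * if i = j then 1 else 0 := fun j => by
    rw [← hval i j, ← integral_const_mul]; congr 1; ext ξ; ring
  simp [this]

lemma lintegral_exp_sum_abs_lt_top :
    ∫⁻ ξ : κ → ℝ, ENNReal.ofReal (exp (∑ k, |ξ k|)) ∂(Measure.pi fun _ => gaussianReal 0 1) < ⊤ := by
  have h1 : Integrable (fun x : ℝ => exp |x|) (gaussianReal 0 1) := by
    have := integrable_exp_mul_abs (X := fun x : ℝ => x) (t := 1) (μ := gaussianReal 0 1)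
      (integrable_exp_mul_gaussianReal 1) (integrable_exp_mul_gaussianReal (-1))
    simpa using this
  have h2 : Integrable (fun ξ : κ → ℝ => ∏ k, exp |ξ k|)
      (Measure.pi fun _ => gaussianReal 0 1) := Integrable.fintype_prod fun _ => h1
  simpa only [exp_sum] using h2.lintegral_lt_top

end Noise

namespace IsGaussianSpace

variable {Ω : Type*} [MeasurableSpace Ω] {μ : Measure Ω} {S : Submodule ℝ (Ω → ℝ)}
  {κ κ' : Type*} [Fintype κ] [Fintype κ'] [Nonempty κ] [Nonempty κ']

lemma lintegral_expMax_add_le_mul [SFinite μ] (hS : IsGaussianSpace S μ) {Ω' : Type*}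
    [MeasurableSpace Ω'] {ν : Measure Ω'} [SFinite ν] {D : κ → Ω → ℝ} (hD : ∀ i, D i ∈ S)
    {M : κ → Ω' → ℝ} {Q : Ω' → ℝ} (hM : ∀ i ξ, M i ξ ≤ Q ξ) (hQ : Measurable Q) (p : κ → ℝ) :
    ∫⁻ x, expMax (fun k => p k + (D k x.1 + M k x.2)) ∂(μ.prod ν) ≤
      (∫⁻ ω, expMax (fun k => p k + D k ω) ∂μ) * ∫⁻ ξ, ENNReal.ofReal (exp (Q ξ)) ∂ν := by
  have mQ : Measurable fun ξ => ENNReal.ofReal (exp (Q ξ)) := by fun_prop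
  rw [← lintegral_prod_mul (hS.measurable_expMax_comp hD p).aemeasurable mQ.aemeasurable]
  refine lintegral_mono fun x => ?_
  rw [← expMax_add_const]
  refine expMax_mono fun k => ?_
  have := hM k x.2
  linarith

/-- Approximate factorization for families with small cross-covariances. -/
lemma lintegral_expMax_prod_le [IsProbabilityMeasure μ] (hS : IsGaussianSpace S μ)
    {A : κ → Ω → ℝ} {C : κ' → Ω → ℝ} (hA : ∀ i, A i ∈ S) (hC : ∀ i, C i ∈ S)
    {r : ℝ} (hr0 : 0 ≤ r) (hr1 : r ≤ 1) (h : ∀ i j, |∫ ω, A i ω * C j ω ∂μ| ≤ r ^ 2)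
    (p : κ → ℝ) (q : κ' → ℝ) :
    ∫⁻ ω, expMax (fun k : κ × κ' => (p k.1 + A k.1 ω) + (q k.2 + C k.2 ω)) ∂μ ≤
      (∫⁻ ω, expMax (fun k => p k + A k ω) ∂μ) * (∫⁻ ω, expMax (fun k => q k + C k ω) ∂μ) *
      (1 + ENNReal.ofReal r * ∫⁻ ξ : κ × κ' → ℝ, ENNReal.ofReal (exp (∑ k, |ξ k|))
        ∂(Measure.pi fun _ => gaussianReal 0 1)) ^ 2 := by
  classical
  set ν : Measure (κ × κ' → ℝ) := Measure.pi fun _ => gaussianReal 0 1 with hν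
  set K : κ × κ' → ℝ := fun k => ∫ ω, A k.1 ω * C k.2 ω ∂μ with hK
  set c : κ → κ × κ' → ℝ := fun i k => if k.1 = i then √|K k| else 0 with hc
  set c' : κ' → κ × κ' → ℝ := fun j k => if k.2 = j then -(SignType.sign (K k) : ℝ) * √|K k| else 0
    with hc'
  set N : κ → (κ × κ' → ℝ) → ℝ := fun i ξ => ∑ k, c i k * ξ k with hN
  set N' : κ' → (κ × κ' → ℝ) → ℝ := fun i ξ => ∑ k, c' i k * ξ k with hN'
  have hK1 : ∀ k, √|K k| ≤ r := fun k => by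
    rw [Real.sqrt_le_left hr0]; exact h k.1 k.2
  have hcr : ∀ i k, |c i k| ≤ r := fun i k => by
    simp only [hc]; split_ifs
    · rw [abs_of_nonneg (Real.sqrt_nonneg _)]; exact hK1 k
    · simpa using hr0
  have hcr' : ∀ i k, |c' i k| ≤ r := fun i k => by
    simp only [hc']; split_ifs
    · rw [abs_mul, abs_neg, abs_of_nonneg (Real.sqrt_nonneg _)]
      refine le_trans (mul_le_of_le_one_left (Real.sqrt_nonneg _) ?_) (hK1 k)
      rcases lt_trichotomy (K k) 0 with h | h | h <;> simp [h]
    · simpa using hr0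
  have hNQ : ∀ (d : κ × κ' → ℝ) (ξ : κ × κ' → ℝ), (∀ k, |d k| ≤ r) →
      ∑ k, d k * ξ k ≤ r * ∑ k, |ξ k| := fun d ξ hd => by
    rw [Finset.mul_sum]
    refine Finset.sum_le_sum fun k _ => (le_abs_self _).trans ?_
    rw [abs_mul]; exact mul_le_mul_of_nonneg_right (hd k) (abs_nonneg _)
  have hcross : ∀ i j, ∫ ξ, N i ξ * N' j ξ ∂ν = -∫ ω, A i ω * C j ω ∂μ := fun i j => by
    rw [hν, integral_sum_mul_sum_pi, Finset.sum_eq_single (i, j)]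
    · simp only [hc, hc', if_true]
      rw [mul_left_comm, Real.mul_self_sqrt (abs_nonneg _), neg_mul, sign_mul_abs]
    · rintro ⟨a, b⟩ _ hab
      by_cases h1 : a = i
      · have : b ≠ j := fun h2 => hab (by rw [h1, h2])
        simp [hc', this]
      · simp [hc, h1]
    · simp
  have hN_mem : ∀ i, N i ∈ _ := fun i => sum_mul_mem_range_linearCombination (c i)
  have hN_mem' : ∀ i, N' i ∈ _ := fun i => sum_mul_mem_range_linearCombination (c' i)
  have hSν : IsGaussianSpace _ ν := isGaussianSpace_pi
  have hP := hS.prod hSν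
  set Q : ENNReal := ∫⁻ ξ, ENNReal.ofReal (exp (r * ∑ k, |ξ k|)) ∂ν with hQ
  have hQm : Measurable fun ξ : κ × κ' → ℝ => r * ∑ k, |ξ k| := by fun_prop
  have hQle : Q ≤ 1 + ENNReal.ofReal r * ∫⁻ ξ, ENNReal.ofReal (exp (∑ k, |ξ k|)) ∂ν := by
    have m2 : Measurable fun ξ : κ × κ' → ℝ => ENNReal.ofReal (exp (∑ k, |ξ k|)) := by fun_prop
    rw [← lintegral_const_mul _ m2]
    refine (lintegral_mono (g := fun ξ => 1 + ENNReal.ofReal r *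
      ENNReal.ofReal (exp (∑ k, |ξ k|))) fun ξ => ?_).trans_eq ?_
    · beta_reduce
      rw [← ENNReal.ofReal_mul hr0, ← ENNReal.ofReal_one,
        ← ENNReal.ofReal_add zero_le_one (by positivity)]
      refine ENNReal.ofReal_le_ofReal ?_
      have := convexOn_exp.2 (mem_univ 0) (mem_univ (∑ k, |ξ k|)) (sub_nonneg.2 hr1) hr0 (by ring)
      simp only [smul_eq_mul, mul_zero, zero_add, exp_zero, mul_one] at this
      linarith
    · rw [lintegral_add_left measurable_const]; simp
  have e0 : ∫⁻ ω, expMax (fun k : κ × κ' => (p k.1 + A k.1 ω) + (q k.2 + C k.2 ω)) ∂μ =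
      ∫⁻ x, expMax (fun k : κ × κ' => (p k.1 + q k.2) + ((A k.1 x.1 + C k.2 x.1) +
        (0 : (κ × κ' → ℝ) → ℝ) x.2))
        ∂(μ.prod ν) := by
    have := hS.lintegral_expMax_congr hP (κ := κ × κ') (X := fun k ω => A k.1 ω + C k.2 ω)
      (Y := fun k x => (A k.1 x.1 + C k.2 x.1) + (0 : (κ × κ' → ℝ) → ℝ) x.2)
      (fun k => S.add_mem (hA k.1) (hC k.2))
      (fun k => add_mem_prod (S.add_mem (hA k.1) (hC k.2)) (Submodule.zero_mem _))
      (fun i j => by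
        refine Eq.trans ?_ (hS.integral_prod_mul_eq hSν (S.add_mem (hA i.1) (hC i.2))
          (S.add_mem (hA j.1) (hC j.2)) (Submodule.zero_mem _) (Submodule.zero_mem _)).symm
        simp) (fun k => p k.1 + q k.2)
    rw [← this]
    refine lintegral_congr fun x => congrArg expMax (funext fun k => ?_)
    ring
  have e1 := hP.lintegral_expMax_le_add (κ := κ × κ')
    (X := fun k x => (A k.1 x.1 + C k.2 x.1) + (0 : (κ × κ' → ℝ) → ℝ) x.2)
    (Z := fun k x => (0 : Ω → ℝ) x.1 + (N k.1 x.2 + N' k.2 x.2))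
    (fun k => add_mem_prod (S.add_mem (hA k.1) (hC k.2)) (Submodule.zero_mem _))
    (fun k => add_mem_prod (Submodule.zero_mem _) (Submodule.add_mem _ (hN_mem k.1) (hN_mem' k.2)))
    (fun i j => by
      refine (hS.integral_prod_mul_eq hSν (S.add_mem (hA i.1) (hC i.2)) (Submodule.zero_mem _)
        (Submodule.zero_mem _) (Submodule.add_mem _ (hN_mem j.1) (hN_mem' j.2))).trans ?_
      simp) (fun k => p k.1 + q k.2)
  have e2 := hP.lintegral_expMax_prod (U := fun i x => A i x.1 + N i x.2)
    (W := fun i x => C i x.1 + N' i x.2) (fun i => add_mem_prod (hA i) (hN_mem i))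
    (fun i => add_mem_prod (hC i) (hN_mem' i)) (fun i j => by
      rw [hS.integral_prod_mul_eq hSν (hA i) (hC j) (hN_mem i) (hN_mem' j), hcross]
      ring) p q
  calc _ = _ := e0
    _ ≤ _ := e1
    _ = _ := by
      refine Eq.trans (lintegral_congr fun x => congrArg expMax (funext fun k => ?_)) e2
      simp only [Pi.zero_apply]; ring
    _ ≤ _ := mul_le_mul'
      (hS.lintegral_expMax_add_le_mul hA (fun i ξ => hNQ _ ξ (hcr i)) hQm p)
      (hS.lintegral_expMax_add_le_mul hC (fun i ξ => hNQ _ ξ (hcr' i)) hQm q)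
    _ = (∫⁻ ω, expMax (fun k => p k + A k ω) ∂μ) * (∫⁻ ω, expMax (fun k => q k + C k ω) ∂μ)
        * Q ^ 2 := by ring
    _ ≤ _ := by gcongr

end IsGaussianSpace

section Tail

/-- The leading term `φ(x) / x` of the standard normal tail. -/
noncomputable def millsTerm (x : ℝ) : ℝ := exp (-x ^ 2 / 2) / (x * √(2 * π))

lemma millsTerm_pos {x : ℝ} (hx : 0 < x) : 0 < millsTerm x := by
  unfold millsTerm; positivity

lemma gaussianReal_Ioi_le {x : ℝ} (hx : 0 < x) (y : ℝ) :
    gaussianReal 0 1 (Ioi (x - y / x)) ≤ ENNReal.ofReal (millsTerm x * exp y) := by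
  rw [gaussianReal_apply_eq_integral 0 one_ne_zero]
  refine ENNReal.ofReal_le_ofReal ?_
  have hi := integrableOn_exp_mul_Ioi (a := -x) (by linarith) (x - y / x)
  calc ∫ z in Ioi (x - y / x), gaussianPDFReal 0 1 z
      ≤ ∫ z in Ioi (x - y / x), (√(2 * π))⁻¹ * exp (x ^ 2 / 2) * exp (-x * z) := by
        refine integral_mono (integrable_gaussianPDFReal _ _).restrict (hi.const_mul _) fun z => ?_
        simp only [gaussianPDFReal_def, sub_zero, NNReal.coe_one, mul_one]
        rw [mul_assoc, ← exp_add]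
        gcongr
        nlinarith [sq_nonneg (x - z)]
    _ = (√(2 * π))⁻¹ * exp (x ^ 2 / 2) * (exp (-x ^ 2 + y) / x) := by
        rw [integral_const_mul, integral_exp_mul_Ioi (by linarith)]
        rw [neg_div_neg_eq, show -x * (x - y / x) = -x ^ 2 + y by field_simp; ring]
    _ = millsTerm x * exp y := by
        rw [millsTerm, exp_add, show -x ^ 2 / 2 = x ^ 2 / 2 + -x ^ 2 by ring, exp_add]
        field_simp

lemma gaussianReal_Ioi_le' {σ u : ℝ} (hσ : 0 < σ) (hu : 0 < u) (y : ℝ) :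
    gaussianReal 0 (σ ^ 2).toNNReal (Ioi (u - y * σ ^ 2 / u)) ≤
      ENNReal.ofReal (millsTerm (u / σ) * exp y) := by
  have e : gaussianReal 0 (σ ^ 2).toNNReal = (gaussianReal 0 1).map (σ * ·) := by
    rw [gaussianReal_map_const_mul, mul_zero, mul_one, Real.toNNReal_of_nonneg (sq_nonneg σ)]
  rw [e, Measure.map_apply (by fun_prop) measurableSet_Ioi]
  refine le_trans (measure_mono fun z hz => ?_) (gaussianReal_Ioi_le (div_pos hu hσ) y)
  have hz' : u - y * σ ^ 2 / u < σ * z := hz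
  have : u / σ - y / (u / σ) < z := by
    rw [← mul_lt_mul_iff_right₀ hσ]
    refine lt_of_eq_of_lt ?_ hz'
    field_simp
  exact this

lemma millsTerm_le_stdNormalTail {y : ℝ} (hy : 0 < y) :
    millsTerm y ≤ (1 + 1 / y ^ 2) * stdNormalTail y := by
  have hd : ∀ z ∈ Ici y, HasDerivAt millsTerm
      (-(gaussianPDFReal 0 1 z * (1 + 1 / z ^ 2))) z := fun z hz => by
    have hz0 : z ≠ 0 := (hy.trans_le hz).ne'
    have h1 : HasDerivAt (fun z : ℝ => exp (-z ^ 2 / 2)) (exp (-z ^ 2 / 2) * (-(2 * z) / 2)) z := by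
      have := (((hasDerivAt_pow 2 z).neg).div_const 2).exp
      simpa using this
    have h2 := h1.div ((hasDerivAt_id z).mul_const √(2 * π)) (by simp [hz0]; positivity)
    refine h2.congr_deriv ?_
    simp only [gaussianPDFReal_def, sub_zero, NNReal.coe_one, mul_one, id, one_mul]
    have : √(2 * π) ≠ 0 := by positivity
    field_simp
    ring
  have hlim : Tendsto millsTerm atTop (nhds 0) := by
    have h1 : Tendsto (fun x : ℝ => (x * √(2 * π))⁻¹) atTop (nhds 0) :=
      tendsto_inv_atTop_zero.comp (tendsto_id.atTop_mul_const (by positivity))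
    refine squeeze_zero' ?_ ?_ h1
    · filter_upwards [eventually_gt_atTop 0] with x hx using (millsTerm_pos hx).le
    · filter_upwards [eventually_gt_atTop 0] with x hx
      rw [millsTerm, div_eq_mul_inv]
      refine mul_le_of_le_one_left (by positivity) (exp_le_one_iff.2 ?_)
      nlinarith [sq_nonneg x]
  have hneg : ∀ z ∈ Ioi y, -(gaussianPDFReal 0 1 z * (1 + 1 / z ^ 2)) ≤ 0 := fun z _ =>
    neg_nonpos.2 (mul_nonneg (gaussianPDFReal_nonneg _ _ _) (by positivity))
  have hmulint := integrableOn_Ioi_deriv_of_nonpos' hd (fun z hz => hneg z hz) hlim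
  have hval := integral_Ioi_of_hasDerivAt_of_nonpos' hd (fun z hz => hneg z hz) hlim
  rw [integral_neg, zero_sub, neg_inj] at hval
  have ht : stdNormalTail y = ∫ z in Ioi y, gaussianPDFReal 0 1 z := by
    rw [stdNormalTail, gaussianReal_apply_eq_integral 0 one_ne_zero, ENNReal.toReal_ofReal]
    exact integral_nonneg fun z => gaussianPDFReal_nonneg _ _ _
  rw [← hval, ht, ← integral_const_mul]
  refine setIntegral_mono_on (by simpa using hmulint.neg)
    ((integrable_gaussianPDFReal 0 1).restrict.const_mul _) measurableSet_Ioi fun z hz => ?_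
  rw [mul_comm]
  refine mul_le_mul_of_nonneg_right ?_ (gaussianPDFReal_nonneg _ _ _)
  have : y ^ 2 ≤ z ^ 2 := pow_le_pow_left₀ hy.le (le_of_lt hz) 2
  gcongr

lemma millsTerm_anti {x y : ℝ} (hx : 0 < x) (h : x ≤ y) : millsTerm y ≤ millsTerm x := by
  unfold millsTerm
  gcongr

end Tail

namespace IsGaussianSpace

variable {Ω : Type*} [MeasurableSpace Ω] {μ : Measure Ω} {S : Submodule ℝ (Ω → ℝ)}
  {κ : Type*} [Fintype κ] [Nonempty κ]

/-- Conditioning on the value at one index bounds the exceedance probability of a finite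
Gaussian family. -/
lemma measure_exists_gt_le [IsProbabilityMeasure μ] (hS : IsGaussianSpace S μ)
    {Y : κ → Ω → ℝ} (hY : ∀ k, Y k ∈ S) (k₀ : κ) {σ : ℝ} (hσ : 0 < σ)
    (hv : ∫ ω, Y k₀ ω * Y k₀ ω ∂μ = σ ^ 2) {c : κ → ℝ}
    (hc : ∀ k, ∫ ω, Y k₀ ω * Y k ω ∂μ = c k * σ ^ 2) {b : ℝ} (hb : 0 < b)
    (hcb : ∀ k, 1 ≤ b * c k) {u : ℝ} (hu : 0 < u) :
    μ {ω | ∃ k, u < Y k ω} ≤ ENNReal.ofReal (millsTerm (u / σ)) *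
      ∫⁻ ω, expMax (fun k => -(b * (u ^ 2 / σ ^ 2) * (1 - c k)) +
        b * u / σ ^ 2 * (Y k ω - Y k₀ ω)) ∂μ := by
  classical
  have hck₀ : c k₀ = 1 := by
    have h := hc k₀
    rw [hv] at h
    have : σ ^ 2 ≠ 0 := by positivity
    exact (mul_right_cancel₀ this (by rw [one_mul]; exact h)).symm
  set W : κ → Ω → ℝ := fun k => Y k - c k • Y k₀ with hW
  have hWS : ∀ k, W k ∈ S := fun k => S.sub_mem (hY k) (S.smul_mem _ (hY k₀))
  have hWV : ∀ k, ∫ ω, Y k₀ ω * W k ω ∂μ = 0 := fun k => by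
    have := hS.integral_mul_sub (hY k) (S.smul_mem (c k) (hY k₀)) (hY k₀)
    simp only [hW, Pi.sub_apply]
    rw [this, hc]
    simp only [Pi.smul_apply, smul_eq_mul, mul_left_comm _ (c k)]
    rw [integral_const_mul, hv, sub_self]
  have hYe : ∀ k ω, Y k ω = c k * Y k₀ ω + W k ω := fun k ω => by simp [hW]
  -- Replace the value at `k₀` by an independent copy.
  have hP := hS.prod hS
  have key : μ {ω | ∃ k, u < Y k ω} =
      (μ.prod μ) {x | ∃ k, u < c k * Y k₀ x.1 + W k x.2} := by
    have hm : MeasurableSet {x : κ → ℝ | ∃ k, u < x k} := by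
      rw [ofPred_exists]
      exact MeasurableSet.iUnion fun k => measurableSet_lt measurable_const (measurable_pi_apply k)
    have hmem : ∀ k, (fun x : Ω × Ω => c k * Y k₀ x.1 + W k x.2) ∈ _ := fun k =>
      add_mem_prod (S.smul_mem (c k) (hY k₀)) (hWS k)
    have e := hS.map_pi_eq hP hY hmem fun i j => by
      refine Eq.trans ?_ (hS.integral_prod_mul_eq hS (S.smul_mem (c i) (hY k₀))
        (S.smul_mem (c j) (hY k₀)) (hWS i) (hWS j)).symm
      have hi := S.smul_mem (c i) (hY k₀)
      have hj := S.smul_mem (c j) (hY k₀)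
      have hYi : Y i = c i • Y k₀ + W i := by simp [hW]
      have hYj : Y j = c j • Y k₀ + W j := by simp [hW]
      have h1 : ∫ ω, Y i ω * Y j ω ∂μ = ∫ ω, ((c i • Y k₀) ω + W i ω) * Y j ω ∂μ := by
        rw [hYi]; rfl
      have h2 : ∀ f ∈ S, ∫ ω, f ω * Y j ω ∂μ = ∫ ω, f ω * (c j • Y k₀) ω ∂μ + ∫ ω, f ω * W j ω ∂μ :=
        fun f hf => by
          rw [← hS.integral_mul_add hj (hWS j) hf]; congr 1; ext ω; rw [hYj]; rfl
      rw [h1, hS.integral_add_mul hi (hWS i) (hY j), h2 _ hi, h2 _ (hWS i)]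
      have z1 : ∫ ω, (c i • Y k₀) ω * W j ω ∂μ = 0 := by
        simp only [Pi.smul_apply, smul_eq_mul, mul_assoc]
        rw [integral_const_mul, hWV, mul_zero]
      have z2 : ∫ ω, W i ω * (c j • Y k₀) ω ∂μ = 0 := by
        simp only [Pi.smul_apply, smul_eq_mul, mul_left_comm _ (c j), mul_comm (W i _)]
        rw [integral_const_mul, hWV, mul_zero]
      rw [z1, z2]; ring
    have a1 := Measure.map_apply (μ := μ)
      (measurable_pi_lambda (fun ω k => Y k ω) fun k => hS.measurable _ (hY k)) hm
    have a2 := Measure.map_apply (μ := μ.prod μ)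
      (measurable_pi_lambda (fun x k => c k * Y k₀ x.1 + W k x.2) fun k => hP.measurable _ (hmem k)) hm
    rw [e, a2] at a1
    exact a1.symm
  set M : Ω → ℝ := fun ω => ⨆ k, (-(b * (u ^ 2 / σ ^ 2) * (1 - c k)) + b * u / σ ^ 2 * W k ω) with hM
  have hM0 : ∀ ω, 0 ≤ M ω := fun ω => by
    refine le_trans (le_of_eq ?_) (le_ciSup (f := fun k => -(b * (u ^ 2 / σ ^ 2) * (1 - c k)) +
      b * u / σ ^ 2 * W k ω) (Finite.bddAbove_range _) k₀)
    simp [hW, hck₀]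
  have hset : MeasurableSet {x : Ω × Ω | ∃ k, u < c k * Y k₀ x.1 + W k x.2} := by
    rw [ofPred_exists]
    refine MeasurableSet.iUnion fun k => measurableSet_lt measurable_const ?_
    exact (((hS.measurable _ (hY k₀)).comp measurable_fst).const_mul _).add
      ((hS.measurable _ (hWS k)).comp measurable_snd)
  rw [key, Measure.prod_apply_symm hset]
  have step1 : ∀ ω, μ ((fun x => (x, ω)) ⁻¹' {x : Ω × Ω | ∃ k, u < c k * Y k₀ x.1 + W k x.2}) ≤
      ENNReal.ofReal (millsTerm (u / σ)) * ENNReal.ofReal (exp (M ω)) := fun ω => by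
    rw [← ENNReal.ofReal_mul (millsTerm_pos (div_pos hu hσ)).le]
    refine le_trans ?_ (gaussianReal_Ioi_le' hσ hu (M ω))
    rw [← hv, ← hS.map_eq (hY k₀), Measure.map_apply (hS.measurable _ (hY k₀)) measurableSet_Ioi]
    refine measure_mono fun x hx => ?_
    obtain ⟨k, hk⟩ := hx
    change u < c k * Y k₀ x + W k ω at hk
    change u - M ω * (∫ ω, Y k₀ ω * Y k₀ ω ∂μ) / u < Y k₀ x
    rw [hv]
    have hMk : -(b * (u ^ 2 / σ ^ 2) * (1 - c k)) + b * u / σ ^ 2 * W k ω ≤ M ω :=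
      le_ciSup (f := fun k => -(b * (u ^ 2 / σ ^ 2) * (1 - c k)) +
      b * u / σ ^ 2 * W k ω) (Finite.bddAbove_range _) k
    by_contra! hle
    -- with `z = u - Y k₀`: `z ≥ M σ² / u ≥ 0` contradicts `b (W - u (1 - c)) > z`.
    set v := Y k₀ x
    have h1 : M ω * σ ^ 2 / u ≤ u - v := by linarith
    have h0 : 0 ≤ u - v := le_trans (by have := hM0 ω; positivity) h1
    have h2 : b * (W k ω - u * (1 - c k)) ≤ M ω * σ ^ 2 / u := by
      rw [le_div_iff₀ hu]
      calc b * (W k ω - u * (1 - c k)) * u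
          = (-(b * (u ^ 2 / σ ^ 2) * (1 - c k)) + b * u / σ ^ 2 * W k ω) * σ ^ 2 := by
            field_simp; ring
        _ ≤ _ := by gcongr
    have h3 : c k * (u - v) < W k ω - u * (1 - c k) := by linarith
    have h4 : (b * c k) * (u - v) < b * (W k ω - u * (1 - c k)) := by
      rw [mul_assoc]; exact mul_lt_mul_of_pos_left h3 hb
    nlinarith [hcb k]
  refine (lintegral_mono step1).trans ?_
  have hmW : Measurable fun ω => ENNReal.ofReal (exp (M ω)) :=
    hS.measurable_expMax_comp (X := fun k => (b * u / σ ^ 2) • W k) (fun k => S.smul_mem _ (hWS k))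
      (fun k => -(b * (u ^ 2 / σ ^ 2) * (1 - c k)))
  rw [lintegral_const_mul _ hmW]
  refine mul_le_mul_right ?_ _
  have j := hS.lintegral_expMax_le_add (X := fun k => (b * u / σ ^ 2) • W k)
    (Z := fun k => (b * u / σ ^ 2 * (c k - 1)) • Y k₀) (fun k => S.smul_mem _ (hWS k))
    (fun k => S.smul_mem _ (hY k₀)) (fun i j => by
      simp only [Pi.smul_apply, smul_eq_mul]
      have : ∀ ω, b * u / σ ^ 2 * W i ω * (b * u / σ ^ 2 * (c j - 1) * Y k₀ ω) =
        (b * u / σ ^ 2 * (b * u / σ ^ 2 * (c j - 1))) * (Y k₀ ω * W i ω) := fun ω => by ring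
      simp only [this]
      rw [integral_const_mul, hWV, mul_zero]) (fun k => -(b * (u ^ 2 / σ ^ 2) * (1 - c k)))
  refine j.trans (le_of_eq (lintegral_congr fun ω => congrArg expMax (funext fun k => ?_)))
  simp only [Pi.smul_apply, smul_eq_mul]
  rw [hYe k ω]
  ring

end IsGaussianSpace

lemma two_mul_mul_le_of_le {x x' y y' θ : ℝ} (hx : 0 ≤ x) (hxx : x ≤ x') (hy : 0 ≤ y) (hyy : y ≤ y') :
    2 * θ * (x' * y') + x ^ 2 + y ^ 2 ≤
      2 * θ * (x * y) + x' ^ 2 + y' ^ 2 + θ ^ 2 * (y' ^ 2 + x ^ 2) := by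
  nlinarith [sq_nonneg (x' - x - θ * y'), sq_nonneg (y' - y - θ * x), mul_nonneg hx (sub_nonneg.2 hxx),
    mul_nonneg hy (sub_nonneg.2 hyy)]

namespace IsGaussianSpace

variable {Ω : Type*} [MeasurableSpace Ω] {μ : Measure Ω} {S : Submodule ℝ (Ω → ℝ)}

/-- Uniform factorization bound over all finite truncations of two sequences distributed as a
given one, whose cross-covariances are small on a fixed finite set of indices. -/
lemma exists_lintegral_expMax_prod_le [IsProbabilityMeasure μ] (hS : IsGaussianSpace S μ)
    {X : ℕ → Ω → ℝ} (hX : ∀ i, X i ∈ S) (p : ℕ → ℝ) {P D : ℝ} (hP : 0 ≤ P) (hD : 0 ≤ D)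
    (hPX : ∀ n : ℕ, ∫⁻ ω, expMax (fun k : Fin (n + 1) => p k + X k ω) ∂μ ≤ ENNReal.ofReal P)
    (hDX : ∀ n : ℕ, ∫⁻ ω, expMax (fun k : Fin (n + 1) => p k + X k ω) ^ 2 ∂μ ≤ ENNReal.ofReal D)
    {η : ℝ} (hη : 0 < η) :
    ∃ m : ℕ, ∃ r > 0, ∀ A C : ℕ → Ω → ℝ, (∀ i, A i ∈ S) → (∀ i, C i ∈ S) →
      (∀ i j, ∫ ω, A i ω * A j ω ∂μ = ∫ ω, X i ω * X j ω ∂μ) →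
      (∀ i j, ∫ ω, C i ω * C j ω ∂μ = ∫ ω, X i ω * X j ω ∂μ) →
      (∀ i ≤ m, ∀ j ≤ m, |∫ ω, A i ω * C j ω ∂μ| ≤ r) → ∀ n : ℕ,
      ∫⁻ ω, expMax (fun k : Fin (n + 1) × Fin (n + 1) => (p k.1 + A k.1 ω) + (p k.2 + C k.2 ω)) ∂μ ≤
        ENNReal.ofReal (P ^ 2 + η) := by
  -- real-valued maxima
  set x : (ℕ → Ω → ℝ) → ℕ → Ω → ℝ := fun A n ω => exp (⨆ k : Fin (n + 1), (p k + A k ω)) with hx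
  have hx0 : ∀ A n ω, 0 ≤ x A n ω := fun A n ω => (exp_pos _).le
  have hxE : ∀ A n ω, expMax (fun k : Fin (n + 1) => p k + A k ω) = ENNReal.ofReal (x A n ω) :=
    fun A n ω => rfl
  have hxmono : ∀ A ω, Monotone fun n => x A n ω := fun A ω a b hab => by
    refine exp_le_exp.2 (ciSup_le fun k => ?_)
    exact le_ciSup (f := fun k : Fin (b + 1) => p k + A k ω) (Finite.bddAbove_range _)
      (Fin.castLE (by omega) k)
  have hxm : ∀ A : ℕ → Ω → ℝ, (∀ i, A i ∈ S) → ∀ n, Measurable (x A n) := fun A hA n =>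
    measurable_exp.comp (Measurable.iSup fun k => (hS.measurable _ (hA k)).const_add (p k))
  have hlaw : ∀ A : ℕ → Ω → ℝ, (∀ i, A i ∈ S) →
      (∀ i j, ∫ ω, A i ω * A j ω ∂μ = ∫ ω, X i ω * X j ω ∂μ) → ∀ n,
      ∫⁻ ω, ENNReal.ofReal (x A n ω ^ 2) ∂μ = ∫⁻ ω, ENNReal.ofReal (x X n ω ^ 2) ∂μ ∧
      ∫⁻ ω, ENNReal.ofReal (x A n ω) ∂μ = ∫⁻ ω, ENNReal.ofReal (x X n ω) ∂μ := fun A hA h n => by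
    have hm : Measurable fun z : Fin (n + 1) → ℝ => expMax fun k : Fin (n + 1) => p k + z k :=
      measurable_expMax.comp (by fun_prop)
    constructor
    · have := hS.lintegral_comp_eq hS (X := fun k : Fin (n + 1) => A k) (Y := fun k => X k)
        (fun k => hA k) (fun k => hX k) (fun i j => h i j) (hm.pow_const 2)
      simpa only [hxE, ← ENNReal.ofReal_pow (hx0 _ _ _)] using this
    · exact hS.lintegral_comp_eq hS (X := fun k : Fin (n + 1) => A k) (Y := fun k => X k)
        (fun k => hA k) (fun k => hX k) (fun i j => h i j) hm
  have hDX' : ∀ n, ∫⁻ ω, ENNReal.ofReal (x X n ω ^ 2) ∂μ ≤ ENNReal.ofReal D := fun n => by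
    simpa only [hxE, ← ENNReal.ofReal_pow (hx0 _ _ _)] using hDX n
  have hsq : ∀ A : ℕ → Ω → ℝ, (∀ i, A i ∈ S) →
      (∀ i j, ∫ ω, A i ω * A j ω ∂μ = ∫ ω, X i ω * X j ω ∂μ) → ∀ n, MemLp (x A n) 2 μ :=
    fun A hA h n => by
    rw [memLp_two_iff_integrable_sq (hxm A hA n).aestronglyMeasurable]
    refine ⟨((hxm A hA n).pow_const 2).aestronglyMeasurable, ?_⟩
    rw [hasFiniteIntegral_iff_ofReal (ae_of_all _ fun ω => sq_nonneg _), (hlaw A hA h n).1]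
    exact (hDX' n).trans_lt ENNReal.ofReal_lt_top
  set s : ℕ → ℝ := fun n => ∫ ω, x X n ω ^ 2 ∂μ with hs
  have hsA : ∀ A : ℕ → Ω → ℝ, (∀ i, A i ∈ S) →
      (∀ i j, ∫ ω, A i ω * A j ω ∂μ = ∫ ω, X i ω * X j ω ∂μ) → ∀ n, ∫ ω, x A n ω ^ 2 ∂μ = s n :=
    fun A hA h n => by
    rw [hs, integral_eq_lintegral_of_nonneg_ae (ae_of_all _ fun ω => sq_nonneg _)
      ((hxm A hA n).pow_const 2).aestronglyMeasurable, (hlaw A hA h n).1,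
      ← integral_eq_lintegral_of_nonneg_ae (ae_of_all _ fun ω => sq_nonneg _)
      ((hxm X hX n).pow_const 2).aestronglyMeasurable]
  have hsmono : Monotone s := fun a b hab =>
    integral_mono (hsq X hX (fun _ _ => rfl) a).integrable_sq
      (hsq X hX (fun _ _ => rfl) b).integrable_sq fun ω =>
        pow_le_pow_left₀ (hx0 _ _ _) (hxmono X ω hab) 2
  have hsD : ∀ n, s n ≤ D := fun n => by
    rw [hs]; beta_reduce
    rw [integral_eq_lintegral_of_nonneg_ae (ae_of_all _ fun ω => sq_nonneg _)
      ((hxm X hX n).pow_const 2).aestronglyMeasurable]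
    exact ENNReal.toReal_le_of_le_ofReal hD (hDX' n)
  set θ : ℝ := η / (2 * (1 + D)) with hθ
  have hθ0 : 0 < θ := by positivity
  obtain ⟨m, hm⟩ : ∃ m, ∀ n, s n ≤ s m + θ ^ 2 := by
    have hb : BddAbove (range s) := ⟨D, by rintro _ ⟨n, rfl⟩; exact hsD n⟩
    obtain ⟨m, hm⟩ := exists_lt_of_lt_ciSup (f := s) (b := (⨆ n, s n) - θ ^ 2)
      (by linarith [pow_pos hθ0 2])
    exact ⟨m, fun n => by linarith [le_ciSup hb n]⟩
  set L : ENNReal := ∫⁻ ξ : Fin (m + 1) × Fin (m + 1) → ℝ, ENNReal.ofReal (exp (∑ k, |ξ k|))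
    ∂(Measure.pi fun _ => gaussianReal 0 1) with hL
  have hLt : L ≠ ⊤ := lintegral_exp_sum_abs_lt_top.ne
  obtain ⟨r, hr0, hr1, hr⟩ : ∃ r : ℝ, 0 < r ∧ r ≤ 1 ∧
      P * P * (1 + r * L.toReal) ^ 2 ≤ P ^ 2 + η / 2 := by
    have ht : Tendsto (fun r : ℝ => P * P * (1 + r * L.toReal) ^ 2) (nhdsWithin 0 (Ioi 0))
        (nhds (P * P * (1 + 0 * L.toReal) ^ 2)) := by
      refine Tendsto.mono_left (Continuous.tendsto ?_ 0) nhdsWithin_le_nhds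
      fun_prop
    have h1 := ht.eventually_le_const (u := P ^ 2 + η / 2) (by nlinarith)
    have h2 : ∀ᶠ r : ℝ in nhdsWithin 0 (Ioi 0), r ≤ 1 :=
      nhdsWithin_le_nhds (eventually_le_nhds zero_lt_one)
    obtain ⟨r, ⟨h3, h4⟩, h5⟩ := ((h1.and h2).and self_mem_nhdsWithin).exists
    exact ⟨r, h5, h4, h3⟩
  refine ⟨m, r ^ 2, by positivity, fun A C hA hC hAX hCX hAC => ?_⟩
  have hpair : ∀ n ω, expMax (fun k : Fin (n + 1) × Fin (n + 1) =>
      (p k.1 + A k.1 ω) + (p k.2 + C k.2 ω)) = ENNReal.ofReal (x A n ω * x C n ω) := fun n ω => by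
    rw [ENNReal.ofReal_mul (hx0 _ _ _)]
    exact expMax_prod_add (fun k : Fin (n + 1) => p k + A k ω) (fun k : Fin (n + 1) => p k + C k ω)
  have hmulint : ∀ n n', Integrable (fun ω => x A n ω * x C n' ω) μ := fun n n' =>
    (hsq A hA hAX n).integrable_mul (hsq C hC hCX n')
  have hmain : ∫ ω, x A m ω * x C m ω ∂μ ≤ P ^ 2 + η / 2 := by
    have h1 := hS.lintegral_expMax_prod_le (A := fun k : Fin (m + 1) => A k)
      (C := fun k : Fin (m + 1) => C k) (fun k => hA k) (fun k => hC k) hr0.le hr1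
      (fun i j => hAC i (by omega) j (by omega)) (fun k => p k) (fun k => p k)
    simp only [hpair, hxE] at h1
    rw [(hlaw A hA hAX m).2, (hlaw C hC hCX m).2] at h1
    rw [integral_eq_lintegral_of_nonneg_ae
      (ae_of_all _ fun ω => mul_nonneg (hx0 _ _ _) (hx0 _ _ _)) (hmulint m m).aestronglyMeasurable]
    refine ENNReal.toReal_le_of_le_ofReal (by positivity) (h1.trans ?_)
    calc _ ≤ ENNReal.ofReal P * ENNReal.ofReal P * (1 + ENNReal.ofReal r * L) ^ 2 := by
          gcongr <;> exact hPX m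
      _ = ENNReal.ofReal (P * P * (1 + r * L.toReal) ^ 2) := by
          rw [ENNReal.ofReal_mul (by positivity), ENNReal.ofReal_mul hP,
            ENNReal.ofReal_pow (by positivity), ENNReal.ofReal_add zero_le_one (by positivity),
            ENNReal.ofReal_mul hr0.le, ENNReal.ofReal_toReal hLt, ENNReal.ofReal_one]
      _ ≤ _ := ENNReal.ofReal_le_ofReal hr
  have hbig : ∀ n, m ≤ n → ∫ ω, x A n ω * x C n ω ∂μ ≤ P ^ 2 + η := fun n hn => by
    have iA := fun n => (hsq A hA hAX n).integrable_sq
    have iC := fun n => (hsq C hC hCX n).integrable_sq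
    have h1 := integral_mono (μ := μ)
      (((((hmulint n n).const_mul (2 * θ)).add (iA m)).add (iC m)))
      (((((hmulint m m).const_mul (2 * θ)).add (iA n)).add (iC n)).add
        (((iC n).add (iA m)).const_mul (θ ^ 2)))
      fun ω => two_mul_mul_le_of_le (θ := θ) (hx0 A m ω) (hxmono A ω hn) (hx0 C m ω) (hxmono C ω hn)
    have e1 : ∫ ω, (2 * θ * (x A n ω * x C n ω) + x A m ω ^ 2 + x C m ω ^ 2) ∂μ =
        2 * θ * ∫ ω, x A n ω * x C n ω ∂μ + s m + s m := by
      have i1 : Integrable (fun ω => 2 * θ * (x A n ω * x C n ω) + x A m ω ^ 2) μ :=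
        ((hmulint n n).const_mul (2 * θ)).add (iA m)
      rw [integral_add i1 (iC m), integral_add ((hmulint n n).const_mul (2 * θ)) (iA m),
        integral_const_mul, hsA A hA hAX, hsA C hC hCX]
    have e2 : ∫ ω, (2 * θ * (x A m ω * x C m ω) + x A n ω ^ 2 + x C n ω ^ 2 +
        θ ^ 2 * (x C n ω ^ 2 + x A m ω ^ 2)) ∂μ =
        2 * θ * ∫ ω, x A m ω * x C m ω ∂μ + s n + s n + θ ^ 2 * (s n + s m) := by
      have i1 : Integrable (fun ω => 2 * θ * (x A m ω * x C m ω) + x A n ω ^ 2) μ :=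
        ((hmulint m m).const_mul (2 * θ)).add (iA n)
      have i2 : Integrable (fun ω => 2 * θ * (x A m ω * x C m ω) + x A n ω ^ 2 + x C n ω ^ 2) μ :=
        i1.add (iC n)
      have i3 : Integrable (fun ω => θ ^ 2 * (x C n ω ^ 2 + x A m ω ^ 2)) μ :=
        ((iC n).add (iA m)).const_mul (θ ^ 2)
      rw [integral_add i2 i3, integral_add i1 (iC n),
        integral_add ((hmulint m m).const_mul (2 * θ)) (iA n), integral_const_mul, integral_const_mul,
        integral_add (iC n) (iA m), hsA A hA hAX, hsA C hC hCX, hsA A hA hAX]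
    have h2 : 2 * θ * ∫ ω, x A n ω * x C n ω ∂μ + s m + s m ≤
        2 * θ * ∫ ω, x A m ω * x C m ω ∂μ + s n + s n + θ ^ 2 * (s n + s m) := by
      rw [← e1, ← e2]; exact h1
    have h3 : θ * (1 + D) = η / 2 := by rw [hθ]; field_simp
    have h4 : 2 * θ * ∫ ω, x A n ω * x C n ω ∂μ ≤ 2 * θ * (P ^ 2 + η) := by
      have := hm n
      have := hsD n
      have := hsD m
      have h5 : θ ^ 2 * (s n + s m) ≤ θ ^ 2 * (2 * D) := by gcongr; linarith
      have h6 : 2 * θ * ∫ ω, x A m ω * x C m ω ∂μ ≤ 2 * θ * (P ^ 2 + η / 2) := by gcongr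
      nlinarith
    exact le_of_mul_le_mul_left h4 (by positivity)
  intro n
  simp only [hpair]
  rw [← ofReal_integral_eq_lintegral_ofReal (hmulint n n)
    (ae_of_all _ fun ω => mul_nonneg (hx0 _ _ _) (hx0 _ _ _))]
  refine ENNReal.ofReal_le_ofReal (le_trans ?_ (hbig (max n m) (le_max_right _ _)))
  refine integral_mono (hmulint _ _) (hmulint _ _) fun ω => ?_
  exact mul_le_mul (hxmono A ω (le_max_left _ _)) (hxmono C ω (le_max_left _ _)) (hx0 _ _ _)
    (hx0 _ _ _)

end IsGaussianSpace

/-- Fractional Brownian motion with Hurst index `H`, indexed by `ℝ` and constrained on `[0, ∞)`. -/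
structure IsFBM {Ω : Type*} [MeasurableSpace Ω] (B : ℝ → Ω → ℝ) (H : ℝ) (μ : Measure Ω) :
    Prop where
  measurable : ∀ t : ℝ, Measurable (B t)
  zero : ∀ ω, B 0 ω = 0
  continuous : ∀ᵐ ω ∂μ, Continuous fun t => B t ω
  gaussian : ∀ (n : ℕ) (c : Fin n → ℝ) (t : Fin n → ℝ),
    ∃ v : NNReal, μ.map (fun ω => ∑ i, c i * B (t i) ω) = gaussianReal 0 v
  cov : ∀ t s : ℝ, 0 ≤ t → 0 ≤ s →
    ∫ ω, B t ω * B s ω ∂μ = (t ^ (2 * H) + s ^ (2 * H) - |t - s| ^ (2 * H)) / 2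

namespace IsFBM

section

variable {Ω : Type*} {B : ℝ → Ω → ℝ} {H : ℝ}

lemma mem_span (B : ℝ → Ω → ℝ) (t : ℝ) : B t ∈ Submodule.span ℝ (range B) :=
  Submodule.subset_span ⟨t, rfl⟩

lemma const_mul_mem_span (B : ℝ → Ω → ℝ) (c t : ℝ) :
    (fun ω => c * B t ω) ∈ Submodule.span ℝ (range B) :=
  Submodule.smul_mem _ c (mem_span B t)

lemma sub_mem_span (B : ℝ → Ω → ℝ) (s t : ℝ) :
    (fun ω => B s ω - B t ω) ∈ Submodule.span ℝ (range B) :=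
  Submodule.sub_mem _ (mem_span B s) (mem_span B t)

lemma le_iSup_pickands {ω : Ω} (hω : Continuous fun t => B t ω) (hH : 0 < H) {lam t : ℝ}
    (ht : t ∈ Icc 0 lam) :
    √2 * B t ω - t ^ (2 * H) ≤ ⨆ t : Icc (0:ℝ) lam, (√2 * B (t:ℝ) ω - (t:ℝ) ^ (2 * H)) := by
  have hc : Continuous fun t : Icc (0:ℝ) lam => √2 * B (t:ℝ) ω - (t:ℝ) ^ (2 * H) :=
    (continuous_const.mul (hω.comp continuous_subtype_val)).sub
      (continuous_subtype_val.rpow_const fun _ => Or.inr (by positivity))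
  exact le_ciSup (isCompact_range hc).bddAbove (⟨t, ht⟩ : Icc (0:ℝ) lam)

end

variable {Ω : Type*} [MeasurableSpace Ω] {μ : Measure Ω} {B : ℝ → Ω → ℝ} {H : ℝ}

lemma isGaussianSpace (hB : IsFBM B H μ) :
    IsGaussianSpace (Submodule.span ℝ (range B)) μ := by
  have key : ∀ f ∈ Submodule.span ℝ (range B), ∃ (n : ℕ) (c : Fin n → ℝ) (t : Fin n → ℝ),
      f = fun ω => ∑ i, c i * B (t i) ω := by
    intro f hf
    obtain ⟨n, c, g, rfl⟩ := Submodule.mem_span_set'.1 hf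
    choose t ht using fun i => (g i).2
    refine ⟨n, c, t, ?_⟩
    ext ω
    simp [Finset.sum_apply, ht]
  refine ⟨fun f hf => ?_, fun f hf => ?_⟩
  · obtain ⟨n, c, t, rfl⟩ := key f hf
    exact Finset.measurable_sum _ fun i _ => (hB.measurable _).const_mul _
  · obtain ⟨n, c, t, rfl⟩ := key f hf
    exact hB.gaussian n c t

lemma integral_sub_mul_sub (hB : IsFBM B H μ) {p q r s : ℝ} (hp : 0 ≤ p) (hq : 0 ≤ q)
    (hr : 0 ≤ r) (hs : 0 ≤ s) :
    ∫ ω, (B p ω - B q ω) * (B r ω - B s ω) ∂μ =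
      (|p - s| ^ (2 * H) + |q - r| ^ (2 * H) - |p - r| ^ (2 * H) - |q - s| ^ (2 * H)) / 2 := by
  have hS := hB.isGaussianSpace
  have h := mem_span B
  rw [hS.integral_sub_mul (h p) (h q) (sub_mem_span B r s), hS.integral_mul_sub (h r) (h s) (h p),
    hS.integral_mul_sub (h r) (h s) (h q), hB.cov p r hp hr, hB.cov p s hp hs, hB.cov q r hq hr,
    hB.cov q s hq hs]
  ring

lemma lintegral_expMax_le (hB : IsFBM B H μ) (hH : 0 < H) {lam : ℝ}
    (hi : Integrable (fun ω => exp (⨆ t : Icc (0:ℝ) lam,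
      (√2 * B (t:ℝ) ω - (t:ℝ) ^ (2 * H)))) μ)
    {κ : Type*} [Finite κ] [Nonempty κ] (t : κ → ℝ) (ht : ∀ k, t k ∈ Icc 0 lam) :
    ∫⁻ ω, expMax (fun k => -(t k) ^ (2 * H) + √2 * B (t k) ω) ∂μ ≤
      ENNReal.ofReal (∫ ω, exp (⨆ t : Icc (0:ℝ) lam,
        (√2 * B (t:ℝ) ω - (t:ℝ) ^ (2 * H))) ∂μ) := by
  rw [ofReal_integral_eq_lintegral_ofReal hi (ae_of_all _ fun ω => (exp_pos _).le)]
  refine lintegral_mono_ae ?_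
  filter_upwards [hB.continuous] with ω hω
  refine ENNReal.ofReal_le_ofReal (exp_le_exp.2 (ciSup_le fun k => ?_))
  have := le_iSup_pickands hω hH (ht k)
  linarith

lemma lintegral_expMax_sq_le [IsProbabilityMeasure μ] (hB : IsFBM B H μ) (hH : 0 < H) {lam : ℝ}
    (hi : Integrable (fun ω => exp (⨆ t : Icc (0:ℝ) (2 ^ (1 / H) * lam),
      (√2 * B (t:ℝ) ω - (t:ℝ) ^ (2 * H)))) μ)
    {κ : Type*} [Finite κ] [Nonempty κ] (t : κ → ℝ) (ht : ∀ k, t k ∈ Icc 0 lam) :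
    ∫⁻ ω, expMax (fun k => -(t k) ^ (2 * H) + √2 * B (t k) ω) ^ 2 ∂μ ≤
      ENNReal.ofReal ((∫ ω, exp (⨆ t : Icc (0:ℝ) (2 ^ (1 / H) * lam),
        (√2 * B (t:ℝ) ω - (t:ℝ) ^ (2 * H))) ∂μ) * exp (2 * lam ^ (2 * H))) := by
  have := Fintype.ofFinite κ
  set c : ℝ := 2 ^ (1 / H) with hc
  have hc0 : 0 < c := by positivity
  have hcp : c ^ (2 * H) = 4 := by
    rw [hc, ← rpow_mul zero_le_two, show 1 / H * (2 * H) = (2:ℕ) by field_simp; norm_num, rpow_natCast]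
    norm_num
  have h1 : ∀ ω, expMax (fun k => -(t k) ^ (2 * H) + √2 * B (t k) ω) ^ 2 =
      expMax (fun k => -(2 * (t k) ^ (2 * H)) + 2 * √2 * B (t k) ω) := fun ω => by
    unfold expMax
    rw [← ENNReal.ofReal_pow (exp_pos _).le, ← exp_nat_mul, Nat.cast_ofNat,
      Real.mul_iSup_of_nonneg zero_le_two]
    congr; ext k; ring
  simp only [h1]
  have h2 := hB.isGaussianSpace.lintegral_expMax_congr hB.isGaussianSpace
    (X := fun k ω => 2 * √2 * B (t k) ω) (Y := fun k ω => √2 * B (c * t k) ω)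
    (fun k => const_mul_mem_span B _ _) (fun k => const_mul_mem_span B _ _) (fun i j => by
      have hq : √2 * √2 = 2 := mul_self_sqrt zero_le_two
      have e1 : ∀ ω, 2 * √2 * B (t i) ω * (2 * √2 * B (t j) ω) = 8 * (B (t i) ω * B (t j) ω) :=
        fun ω => by linear_combination 4 * (B (t i) ω * B (t j) ω) * hq
      have e2 : ∀ ω, √2 * B (c * t i) ω * (√2 * B (c * t j) ω) =
          2 * (B (c * t i) ω * B (c * t j) ω) :=
        fun ω => by linear_combination (B (c * t i) ω * B (c * t j) ω) * hq
      simp only [e1, e2]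
      rw [integral_const_mul, integral_const_mul, hB.cov _ _ (ht i).1 (ht j).1,
        hB.cov _ _ (mul_nonneg hc0.le (ht i).1) (mul_nonneg hc0.le (ht j).1), ← mul_sub, abs_mul,
        abs_of_pos hc0, mul_rpow hc0.le (ht i).1, mul_rpow hc0.le (ht j).1,
        mul_rpow hc0.le (abs_nonneg _), hcp]
      ring) (fun k => -(2 * (t k) ^ (2 * H)))
  rw [h2, ENNReal.ofReal_mul' (exp_pos _).le]
  calc _ ≤ ∫⁻ ω, expMax (fun k => (-(c * t k) ^ (2 * H) + √2 * B (c * t k) ω) +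
        2 * lam ^ (2 * H)) ∂μ := by
        refine lintegral_mono fun ω => expMax_mono fun k => ?_
        have : (t k) ^ (2 * H) ≤ lam ^ (2 * H) := rpow_le_rpow (ht k).1 (ht k).2 (by positivity)
        rw [mul_rpow hc0.le (ht k).1, hcp]
        linarith
    _ = (∫⁻ ω, expMax (fun k => -(c * t k) ^ (2 * H) + √2 * B (c * t k) ω) ∂μ) *
        ENNReal.ofReal (exp (2 * lam ^ (2 * H))) := by
        simp only [expMax_add_const]
        exact lintegral_mul_const' _ _ ENNReal.ofReal_ne_top
    _ ≤ _ := by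
        gcongr
        exact hB.lintegral_expMax_le hH hi (fun k => c * t k) fun k =>
          ⟨mul_nonneg hc0.le (ht k).1, mul_le_mul_of_nonneg_left (ht k).2 hc0.le⟩

/-- Limiting factorization bound for two nearly independent rescaled copies of a fractional
Brownian motion on a grid. -/
lemma exists_lintegral_expMax_prod_le [IsProbabilityMeasure μ] (hB : IsFBM B H μ) (hH : 0 < H)
    {lam : ℝ} (hi : ∀ l ≥ lam, Integrable (fun ω => exp (⨆ t : Icc (0:ℝ) l,
      (√2 * B (t:ℝ) ω - (t:ℝ) ^ (2 * H)))) μ)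
    {d : ℕ → ℝ} (hd : ∀ n, d n ∈ Icc 0 lam) {η : ℝ} (hη : 0 < η) :
    ∃ m : ℕ, ∃ r > 0, ∀ A C : ℕ → Ω → ℝ, (∀ i, A i ∈ Submodule.span ℝ (range B)) →
      (∀ i, C i ∈ Submodule.span ℝ (range B)) →
      (∀ i j, ∫ ω, A i ω * A j ω ∂μ =
        d i ^ (2 * H) + d j ^ (2 * H) - |d i - d j| ^ (2 * H)) →
      (∀ i j, ∫ ω, C i ω * C j ω ∂μ =
        d i ^ (2 * H) + d j ^ (2 * H) - |d i - d j| ^ (2 * H)) →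
      (∀ i ≤ m, ∀ j ≤ m, |∫ ω, A i ω * C j ω ∂μ| ≤ r) → ∀ n : ℕ,
      ∫⁻ ω, expMax (fun k : Fin (n + 1) × Fin (n + 1) =>
        (-(d k.1) ^ (2 * H) + A k.1 ω) + (-(d k.2) ^ (2 * H) + C k.2 ω)) ∂μ ≤
        ENNReal.ofReal ((∫ ω, exp (⨆ t : Icc (0:ℝ) lam,
          (√2 * B (t:ℝ) ω - (t:ℝ) ^ (2 * H))) ∂μ) ^ 2 + η) := by
  have hlam : 0 ≤ lam := (hd 0).1.trans (hd 0).2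
  have hc1 : (1:ℝ) ≤ 2 ^ (1 / H) := one_le_rpow one_le_two (by positivity)
  have hcov : ∀ i j, ∫ ω, (√2 * B (d i) ω) * (√2 * B (d j) ω) ∂μ =
      d i ^ (2 * H) + d j ^ (2 * H) - |d i - d j| ^ (2 * H) := fun i j => by
    have e : ∀ ω, √2 * B (d i) ω * (√2 * B (d j) ω) = 2 * (B (d i) ω * B (d j) ω) := fun ω => by
      linear_combination (B (d i) ω * B (d j) ω) * mul_self_sqrt (zero_le_two (α := ℝ))
    simp only [e]
    rw [integral_const_mul, hB.cov _ _ (hd i).1 (hd j).1]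
    ring
  obtain ⟨m, r, hr, h⟩ := hB.isGaussianSpace.exists_lintegral_expMax_prod_le
    (X := fun i ω => √2 * B (d i) ω) (fun i => const_mul_mem_span B _ _)
    (fun i => -(d i) ^ (2 * H))
    (integral_nonneg fun ω => (exp_pos _).le)
    (mul_nonneg (integral_nonneg fun ω => (exp_pos _).le) (exp_pos _).le)
    (fun n => hB.lintegral_expMax_le hH (hi lam le_rfl) (fun k : Fin (n + 1) => d k) fun k => hd k)
    (fun n => hB.lintegral_expMax_sq_le hH (hi _ (le_mul_of_one_le_left hlam hc1))
      (fun k : Fin (n + 1) => d k) fun k => hd k) hη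
  exact ⟨m, r, hr, fun A C hA hC hAA hCC hAC n =>
    h A C hA hC (fun i j => (hAA i j).trans (hcov i j).symm)
      (fun i j => (hCC i j).trans (hcov i j).symm) hAC n⟩

end IsFBM

lemma abs_rpow_sub_rpow_le {p x y : ℝ} (hp : p ∈ Ioo (0:ℝ) 1) (hy : 1 / 2 ≤ y) (hxy : y ≤ x) :
    |x ^ p - y ^ p| ≤ 2 * (x - y) := by
  have hy0 : 0 < y := by linarith
  have h0 : y ^ p ≤ x ^ p := rpow_le_rpow hy0.le hxy hp.1.le
  rw [abs_of_nonneg (sub_nonneg.2 h0)]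
  have h1 : (1 + (x - y) / y) ^ p ≤ 1 + p * ((x - y) / y) :=
    rpow_one_add_le_one_add_mul_self (by have := div_nonneg (sub_nonneg.2 hxy) hy0.le; linarith)
      hp.1.le hp.2.le
  have h2 : x ^ p = y ^ p * (1 + (x - y) / y) ^ p := by
    rw [← mul_rpow hy0.le (by have := div_nonneg (sub_nonneg.2 hxy) hy0.le; linarith)]
    congr 1; field_simp; ring
  have h3 : y ^ p / y ≤ 2 := by
    rw [← rpow_sub_one hy0.ne', ← neg_sub, rpow_neg hy0.le, ← inv_rpow hy0.le]
    calc y⁻¹ ^ (1 - p) ≤ 2 ^ (1 - p) := by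
          refine rpow_le_rpow (by positivity) ?_ (by linarith [hp.2])
          rw [inv_le_comm₀ hy0 two_pos]; linarith
      _ ≤ 2 ^ (1:ℝ) := rpow_le_rpow_of_exponent_le one_le_two (by linarith [hp.1])
      _ = 2 := rpow_one 2
  calc x ^ p - y ^ p ≤ y ^ p * (1 + p * ((x - y) / y)) - y ^ p := by rw [h2]; gcongr
    _ = (y ^ p / y) * (p * (x - y)) := by field_simp; ring
    _ ≤ 2 * (1 * (x - y)) := by
        have := hp.2; have := hp.1; have := sub_nonneg.2 hxy
        gcongr
    _ = _ := by ring

namespace IsFBM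

variable {Ω : Type*} [MeasurableSpace Ω] {μ : Measure Ω} {B : ℝ → Ω → ℝ} {H : ℝ}

/-- Tail bound for the increments `B t - B s` over a grid in a small square with corner
`(t₀, s₀)`. -/
lemma exists_measure_exists_gt_le [IsProbabilityMeasure μ] (hB : IsFBM B H μ)
    (hH : H ∈ Ioo (0:ℝ) (1 / 2))
    {lam : ℝ} (hi : ∀ l ≥ lam, Integrable (fun ω => exp (⨆ t : Icc (0:ℝ) l,
      (√2 * B (t:ℝ) ω - (t:ℝ) ^ (2 * H)))) μ)
    {d : ℕ → ℝ} (hd0 : d 0 = 0) (hd : ∀ n, d n ∈ Icc 0 lam) {η : ℝ} (hη : 0 < η) :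
    ∃ r > 0, ∀ u w t₀ s₀ : ℝ, 0 < u → 0 < w → ((1 + η) * u) ^ 2 * w ^ (2 * H) = 2 → 0 ≤ s₀ →
      1 / 2 ≤ t₀ - s₀ - 2 * (lam * w) →
      1 ≤ (1 + η) * ((t₀ - s₀ - lam * w) ^ (2 * H) - (lam * w) ^ (2 * H)) →
      2 * ((1 + η) * u) ^ 2 * (lam * w) ≤ r → ∀ n : ℕ,
      μ {ω | ∃ k : Fin (n + 1) × Fin (n + 1),
        u < B (t₀ - w * d k.1) ω - B (s₀ + w * d k.2) ω} ≤
      ENNReal.ofReal (millsTerm (u / (t₀ - s₀) ^ H)) * (ENNReal.ofReal ((∫ ω, exp (⨆ t : Icc (0:ℝ) lam,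
          (√2 * B (t:ℝ) ω - (t:ℝ) ^ (2 * H))) ∂μ) ^ 2 + η) *
        ENNReal.ofReal (exp (2 * ((1 + η) * (t₀ - s₀) ^ (2 * H) - 1) * lam ^ (2 * H)))) := by
  obtain ⟨m, r, hr, hQ⟩ := hB.exists_lintegral_expMax_prod_le hH.1 hi hd hη
  refine ⟨r, hr, fun u w t₀ s₀ hu hw hgw hs hD hc hgr n => ?_⟩
  set D := t₀ - s₀ with hDdef
  set g := (1 + η) * u with hg
  set p := 2 * H with hp
  have hp01 : p ∈ Ioo (0:ℝ) 1 := ⟨by linarith [hH.1], by linarith [hH.2]⟩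
  have hlam : 0 ≤ lam := (hd 0).1.trans (hd 0).2
  have hg0 : 0 < g := by positivity
  have hlw : 0 ≤ lam * w := by positivity
  have ha : ∀ i, 0 ≤ w * d i ∧ w * d i ≤ lam * w := fun i =>
    ⟨mul_nonneg hw.le (hd i).1, by rw [mul_comm lam]; exact mul_le_mul_of_nonneg_left (hd i).2 hw.le⟩
  have hap : ∀ i, g ^ 2 * (w * d i) ^ p = 2 * d i ^ p := fun i => by
    rw [mul_rpow hw.le (hd i).1, ← mul_assoc, hgw]
  have hap' : ∀ i j, g ^ 2 * |w * d i - w * d j| ^ p = 2 * |d i - d j| ^ p := fun i j => by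
    rw [← mul_sub, abs_mul, abs_of_pos hw, mul_rpow hw.le (abs_nonneg _), ← mul_assoc, hgw]
  have hD0 : 0 < D := by linarith
  have hDp : 0 < D ^ p := rpow_pos_of_pos hD0 _
  have ht : ∀ i, 0 ≤ t₀ - w * d i := fun i => by linarith [(ha i).2]
  have hs' : ∀ i, 0 ≤ s₀ + w * d i := fun i => by linarith [(ha i).1]
  have ht0 : 0 ≤ t₀ := by linarith
  have hσ : (D ^ H) ^ 2 = D ^ p := by
    rw [← rpow_natCast, ← rpow_mul hD0.le, hp, mul_comm 2 H]; norm_num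
  have hpow0 : (0:ℝ) ^ p = 0 := zero_rpow hp01.1.ne'
  set b := (1 + η) * D ^ p with hb
  have hb0 : 0 < b := by positivity
  set c : Fin (n + 1) × Fin (n + 1) → ℝ := fun k =>
    ((D - w * d k.2) ^ p + (D - w * d k.1) ^ p - (w * d k.1) ^ p - (w * d k.2) ^ p) / 2 / D ^ p with hcdef
  have hcb : ∀ k, 1 ≤ b * c k := fun k => by
    have e : b * c k = (1 + η) *
      (((D - w * d k.2) ^ p + (D - w * d k.1) ^ p - (w * d k.1) ^ p - (w * d k.2) ^ p) / 2) := by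
      rw [hb, hcdef]; field_simp
    rw [e]
    refine hc.trans (mul_le_mul_of_nonneg_left ?_ (by positivity))
    have h1 : ∀ i, (w * d i) ^ p ≤ (lam * w) ^ p := fun i =>
      rpow_le_rpow (ha i).1 (ha i).2 hp01.1.le
    have h2 : ∀ i, (D - lam * w) ^ p ≤ (D - w * d i) ^ p := fun i =>
      rpow_le_rpow (by linarith) (by linarith [(ha i).2]) hp01.1.le
    linarith [h1 k.1, h1 k.2, h2 k.1, h2 k.2]
  have hb1 : 1 ≤ b := by
    have h := hcb (0, 0)
    have e : c (0, 0) = 1 := by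
      simp only [hcdef, Fin.val_zero, hd0, mul_zero, sub_zero, hpow0]
      field_simp
      norm_num
    rwa [e, mul_one] at h
  have hcov : ∀ k : Fin (n + 1) × Fin (n + 1), ∫ ω, (B t₀ ω - B s₀ ω) *
      (B (t₀ - w * d k.1) ω - B (s₀ + w * d k.2) ω) ∂μ = c k * (D ^ H) ^ 2 := fun k => by
    rw [hB.integral_sub_mul_sub ht0 hs (ht _) (hs' _), hσ, hcdef]
    beta_reduce
    rw [div_mul_cancel₀ _ hDp.ne', show t₀ - (s₀ + w * d k.2) = D - w * d k.2 by ring,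
      show s₀ - (t₀ - w * d k.1) = -(D - w * d k.1) by ring,
      show t₀ - (t₀ - w * d k.1) = w * d k.1 by ring,
      show s₀ - (s₀ + w * d k.2) = -(w * d k.2) by ring, abs_neg, abs_neg,
      abs_of_nonneg (ha _).1, abs_of_nonneg (ha _).1,
      abs_of_nonneg (by linarith [(ha k.2).2] : 0 ≤ D - w * d k.2),
      abs_of_nonneg (by linarith [(ha k.1).2] : 0 ≤ D - w * d k.1)]
  have hvar : ∫ ω, (B t₀ ω - B s₀ ω) * (B t₀ ω - B s₀ ω) ∂μ = (D ^ H) ^ 2 := by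
    rw [hB.integral_sub_mul_sub ht0 hs ht0 hs, hσ, sub_self, sub_self, abs_zero, hpow0,
      abs_sub_comm s₀ t₀, abs_of_pos hD0]
    ring
  have hY0 : ∀ ω, B (t₀ - w * d 0) ω - B (s₀ + w * d 0) ω = B t₀ ω - B s₀ ω := fun ω => by
    simp [hd0]
  have hmain := hB.isGaussianSpace.measure_exists_gt_le
    (Y := fun (k : Fin (n + 1) × Fin (n + 1)) ω => B (t₀ - w * d k.1) ω - B (s₀ + w * d k.2) ω)
    (fun k => sub_mem_span B _ _) (0, 0) (σ := D ^ H) (rpow_pos_of_pos hD0 _)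
    (by simpa only [Fin.val_zero, hY0] using hvar) (c := c)
    (by simpa only [Fin.val_zero, hY0] using hcov) hb0 hcb hu
  refine hmain.trans (mul_le_mul_right ?_ _)
  have hgu : g = b * u / D ^ p := by rw [hg, hb]; field_simp
  have hpt : ∀ ω (k : Fin (n + 1) × Fin (n + 1)),
      -(b * (u ^ 2 / (D ^ H) ^ 2) * (1 - c k)) + b * u / (D ^ H) ^ 2 *
        (B (t₀ - w * d k.1) ω - B (s₀ + w * d k.2) ω -
          (B (t₀ - w * d ((0:Fin (n + 1)):ℕ)) ω - B (s₀ + w * d ((0:Fin (n + 1)):ℕ)) ω)) ≤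
      ((-(d k.1) ^ p + g * (B (t₀ - w * d k.1) ω - B t₀ ω)) +
        (-(d k.2) ^ p + g * (B s₀ ω - B (s₀ + w * d k.2) ω))) +
        2 * (b - 1) * lam ^ p := fun ω k => by
    rw [Fin.val_zero, hY0, hσ, ← hgu]
    have h1 : b * (u ^ 2 / D ^ p) * (1 - c k) = g ^ 2 / b * (D ^ p * (1 - c k)) := by
      rw [hgu]; field_simp
    have h2 : D ^ p * (1 - c k) ≥ ((w * d k.1) ^ p + (w * d k.2) ^ p) / 2 := by
      have e : D ^ p * (1 - c k) = D ^ p -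
        ((D - w * d k.2) ^ p + (D - w * d k.1) ^ p - (w * d k.1) ^ p - (w * d k.2) ^ p) / 2 := by
        rw [hcdef]; field_simp
      have h : ∀ i, (w * d i ≤ lam * w) → (D - w * d i) ^ p ≤ D ^ p := fun i hi =>
        rpow_le_rpow (by linarith) (by linarith [(ha i).1]) hp01.1.le
      linarith [h k.1 (ha _).2, h k.2 (ha _).2]
    have h3 : b * (u ^ 2 / D ^ p) * (1 - c k) ≥ (d k.1 ^ p + d k.2 ^ p) / b := by
      calc (d k.1 ^ p + d k.2 ^ p) / b = g ^ 2 / b * (((w * d k.1) ^ p + (w * d k.2) ^ p) / 2) := by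
            have := hap k.1; have := hap k.2
            field_simp
            linarith
        _ ≤ _ := by rw [h1]; gcongr
    have h4 : ∀ i, d i ^ p - (b - 1) * lam ^ p ≤ d i ^ p / b := fun i => by
      have hx : d i ^ p ≤ lam ^ p := rpow_le_rpow (hd i).1 (hd i).2 hp01.1.le
      have hx0 : 0 ≤ d i ^ p := rpow_nonneg (hd i).1 _
      have : d i ^ p - (b - 1) * d i ^ p ≤ d i ^ p / b := by
        rw [le_div_iff₀ hb0]
        nlinarith [mul_nonneg hx0 (sq_nonneg (b - 1))]
      have := mul_le_mul_of_nonneg_left hx (sub_nonneg.2 hb1)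
      linarith
    have h5 : (d k.1 ^ p + d k.2 ^ p) / b = d k.1 ^ p / b + d k.2 ^ p / b := add_div _ _ _
    linarith [h4 k.1, h4 k.2]
  refine (lintegral_mono fun ω => expMax_mono (hpt ω)).trans ?_
  simp only [expMax_add_const]
  rw [lintegral_mul_const' _ _ ENNReal.ofReal_ne_top]
  refine mul_le_mul_left (hQ (fun i ω => g * (B (t₀ - w * d i) ω - B t₀ ω))
    (fun i ω => g * (B s₀ ω - B (s₀ + w * d i) ω))
    (fun i => Submodule.smul_mem _ g (sub_mem_span B _ _))
    (fun i => Submodule.smul_mem _ g (sub_mem_span B _ _)) (fun i j => ?_) (fun i j => ?_)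
    (fun i _ j _ => ?_) n) _
  all_goals
    simp only [mul_mul_mul_comm g _ g _, integral_const_mul, ← pow_two]
  · rw [hB.integral_sub_mul_sub (ht i) ht0 (ht j) ht0, sub_self, abs_zero, ← hp, hpow0,
      show t₀ - w * d i - t₀ = -(w * d i) by ring, show t₀ - (t₀ - w * d j) = w * d j by ring,
      show t₀ - w * d i - (t₀ - w * d j) = -(w * d i - w * d j) by ring, abs_neg, abs_neg,
      abs_of_nonneg (ha _).1, abs_of_nonneg (ha _).1]
    linear_combination (hap i + hap j - hap' i j) / 2
  · rw [hB.integral_sub_mul_sub hs (hs' i) hs (hs' j), sub_self, abs_zero, ← hp, hpow0,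
      show s₀ - (s₀ + w * d j) = -(w * d j) by ring, show s₀ + w * d i - s₀ = w * d i by ring,
      show s₀ + w * d i - (s₀ + w * d j) = w * d i - w * d j by ring, abs_neg,
      abs_of_nonneg (ha _).1, abs_of_nonneg (ha _).1]
    linear_combination (hap i + hap j - hap' i j) / 2
  · have hai := ha i
    have haj := ha j
    rw [hB.integral_sub_mul_sub (ht i) ht0 hs (hs' j), ← hp,
      show t₀ - w * d i - (s₀ + w * d j) = D - w * d j - w * d i by ring,
      show t₀ - w * d i - s₀ = D - w * d i by ring,
      show t₀ - (s₀ + w * d j) = D - w * d j by ring,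
      abs_of_nonneg (by linarith : 0 ≤ D - w * d j - w * d i),
      abs_of_nonneg (by linarith : 0 ≤ D - w * d i),
      abs_of_nonneg (by linarith : 0 ≤ D - w * d j), abs_of_pos hD0]
    have h1 := abs_le.1 (abs_rpow_sub_rpow_le hp01 (x := D) (y := D - w * d i) (by linarith)
      (by linarith))
    have h2 := abs_le.1 (abs_rpow_sub_rpow_le hp01 (x := D - w * d j) (y := D - w * d j - w * d i)
      (by linarith) (by linarith))
    have h3 : |((D - w * d j - w * d i) ^ p + D ^ p - (D - w * d i) ^ p - (D - w * d j) ^ p) / 2| ≤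
        2 * (lam * w) := by
      rw [abs_le]
      constructor <;> linarith
    rw [abs_mul, abs_of_nonneg (sq_nonneg g)]
    calc _ ≤ g ^ 2 * (2 * (lam * w)) := by gcongr
      _ ≤ r := by linarith

end IsFBM

lemma exists_seq_subset_closure_range {lam : ℝ} (hlam : 0 ≤ lam) :
    ∃ d : ℕ → ℝ, d 0 = 0 ∧ (∀ n, d n ∈ Icc 0 lam) ∧ Icc 0 lam ⊆ closure (range d) := by
  have : Nonempty (Icc 0 lam) := ⟨⟨0, le_rfl, hlam⟩⟩
  set f : ℕ → ℝ := fun n => (TopologicalSpace.denseSeq (Icc 0 lam) n : ℝ) with hf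
  refine ⟨fun n => Nat.casesOn n 0 f, rfl, fun n => ?_, fun x hx => ?_⟩
  · cases n with
    | zero => exact ⟨le_rfl, hlam⟩
    | succ n => exact (TopologicalSpace.denseSeq (Icc 0 lam) n).2
  · have h := TopologicalSpace.denseRange_denseSeq (Icc 0 lam) ⟨x, hx⟩
    have h2 := image_closure_subset_closure_image continuous_subtype_val
      (mem_image_of_mem Subtype.val h)
    refine closure_mono ?_ h2
    rintro _ ⟨_, ⟨n, rfl⟩, rfl⟩
    exact ⟨n + 1, rfl⟩

section

variable {Ω : Type*} [MeasurableSpace Ω] {μ : Measure Ω} {B : ℝ → Ω → ℝ} {lam w u t₀ s₀ : ℝ}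
  {d : ℕ → ℝ}

lemma measure_exists_gt_square_le (hB : ∀ᵐ ω ∂μ, Continuous fun t => B t ω)
    (hw : 0 < w) (hd : Icc 0 lam ⊆ closure (range d)) {K : ENNReal}
    (hK : ∀ n : ℕ, μ {ω | ∃ k : Fin (n + 1) × Fin (n + 1),
      u < B (t₀ - w * d k.1) ω - B (s₀ + w * d k.2) ω} ≤ K) :
    μ {ω | ∃ t ∈ Icc (t₀ - lam * w) t₀, ∃ s ∈ Icc s₀ (s₀ + lam * w), u < B t ω - B s ω} ≤ K := by
  set G : ℕ → Set Ω := fun n => {ω | ∃ k : Fin (n + 1) × Fin (n + 1),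
      u < B (t₀ - w * d k.1) ω - B (s₀ + w * d k.2) ω} with hG
  have hmono : Monotone G := fun a b hab ω ⟨k, hk⟩ =>
    ⟨(Fin.castLE (by omega) k.1, Fin.castLE (by omega) k.2), hk⟩
  have hle : μ (⋃ n, G n) ≤ K := by
    rw [hmono.measure_iUnion]
    exact iSup_le hK
  refine (measure_mono_ae ?_).trans hle
  filter_upwards [hB] with ω hω
  rintro ⟨t, ht, s, hs, hu⟩
  have hc : Continuous fun z : ℝ × ℝ => B (t₀ - w * z.1) ω - B (s₀ + w * z.2) ω :=
    (hω.comp (by fun_prop : Continuous fun z : ℝ × ℝ => t₀ - w * z.1)).sub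
      (hω.comp (by fun_prop : Continuous fun z : ℝ × ℝ => s₀ + w * z.2))
  have ha : (t₀ - t) / w ∈ Icc 0 lam :=
    ⟨div_nonneg (by linarith [ht.2]) hw.le, (div_le_iff₀ hw).2 (by linarith [ht.1])⟩
  have hb : (s - s₀) / w ∈ Icc 0 lam :=
    ⟨div_nonneg (by linarith [hs.1]) hw.le, (div_le_iff₀ hw).2 (by linarith [hs.2])⟩
  have hmem : ((t₀ - t) / w, (s - s₀) / w) ∈ closure (range d ×ˢ range d) := by
    rw [closure_prod_eq]; exact ⟨hd ha, hd hb⟩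
  obtain ⟨z, hz, ⟨⟨i, hi⟩, ⟨j, hj⟩⟩⟩ := mem_closure_iff.1 hmem
    {z : ℝ × ℝ | u < B (t₀ - w * z.1) ω - B (s₀ + w * z.2) ω} (isOpen_lt continuous_const hc) (by
      have e1 : t₀ - w * ((t₀ - t) / w) = t := by field_simp; ring
      have e2 : s₀ + w * ((s - s₀) / w) = s := by field_simp; ring
      simpa only [mem_ofPred_eq, e1, e2] using hu)
  refine mem_iUnion.2 ⟨max i j, ((⟨i, by omega⟩, ⟨j, by omega⟩) :
    Fin (max i j + 1) × Fin (max i j + 1)), ?_⟩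
  simpa only [mem_ofPred_eq, hi, hj] using hz

lemma measure_lt_supYOnRect_le (hB : ∀ᵐ ω ∂μ, Continuous fun t => B t ω)
    (hlam : 0 < lam) (hw : 0 < w) (hd : Icc 0 lam ⊆ closure (range d)) {R t₂ s₁ : ℝ} (hR : 0 ≤ R)
    {K : ENNReal}
    (hK : ∀ t₀ s₀, s₁ ≤ s₀ → t₂ - s₁ - 2 * R ≤ t₀ - s₀ → t₀ - s₀ ≤ t₂ - s₁ → ∀ n : ℕ,
      μ {ω | ∃ k : Fin (n + 1) × Fin (n + 1),
        u < B (t₀ - w * d k.1) ω - B (s₀ + w * d k.2) ω} ≤ K) :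
    μ {ω | u < supYOnRect B (t₂ - R) t₂ s₁ (s₁ + R) ω} ≤
      ENNReal.ofReal ((R / (lam * w) + 1) ^ 2) * K := by
  set ℓ := lam * w with hℓ
  have hℓ0 : 0 < ℓ := by positivity
  set N := ⌊R / ℓ⌋₊ + 1 with hN
  have hNle : (N : ℝ) ≤ R / ℓ + 1 := by
    rw [hN]; push_cast; gcongr; exact Nat.floor_le (by positivity)
  set Q : ℕ × ℕ → Set Ω := fun a => {ω | ∃ t ∈ Icc (t₂ - a.1 * ℓ - ℓ) (t₂ - a.1 * ℓ),
    ∃ s ∈ Icc (s₁ + a.2 * ℓ) (s₁ + a.2 * ℓ + ℓ), u < B t ω - B s ω} with hQ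
  have hfl : ∀ x, 0 ≤ x → x ≤ R → ∃ a ∈ Finset.range N, a * ℓ ≤ x ∧ x ≤ a * ℓ + ℓ :=
    fun x hx0 hx => by
    refine ⟨⌊x / ℓ⌋₊, Finset.mem_range.2 (Nat.lt_succ_of_le (Nat.floor_le_floor (by gcongr))), ?_, ?_⟩
    · rw [← le_div_iff₀ hℓ0]; exact Nat.floor_le (by positivity)
    · have := (div_lt_iff₀ hℓ0).1 (Nat.lt_floor_add_one (x / ℓ))
      linarith
  have haR : ∀ a ∈ Finset.range N, (a : ℝ) * ℓ ≤ R := fun a ha => by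
    rw [← le_div_iff₀ hℓ0]
    exact (Nat.le_floor_iff (by positivity)).1 (Nat.lt_succ_iff.1 (Finset.mem_range.1 ha))
  have hsub : μ {ω | u < supYOnRect B (t₂ - R) t₂ s₁ (s₁ + R) ω} ≤
      μ (⋃ a ∈ Finset.range N ×ˢ Finset.range N, Q a) := by
    refine measure_mono_ae ?_
    filter_upwards with ω hω
    have : Nonempty (Icc (t₂ - R) t₂) := ⟨⟨t₂, by linarith, le_rfl⟩⟩
    have : Nonempty (Icc s₁ (s₁ + R)) := ⟨⟨s₁, le_rfl, by linarith⟩⟩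
    obtain ⟨⟨t, ht⟩, h1⟩ := exists_lt_of_lt_ciSup hω
    obtain ⟨⟨s, hs⟩, h2⟩ := exists_lt_of_lt_ciSup h1
    obtain ⟨a, haN, ha1, ha2⟩ := hfl (t₂ - t) (by linarith [ht.2]) (by linarith [ht.1])
    obtain ⟨b, hbN, hb1, hb2⟩ := hfl (s - s₁) (by linarith [hs.1]) (by linarith [hs.2])
    refine mem_iUnion₂.2 ⟨(a, b), Finset.mem_product.2 ⟨haN, hbN⟩, t, ⟨?_, ?_⟩, s, ⟨?_, ?_⟩, h2⟩
    all_goals dsimp only; linarith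
  refine hsub.trans ((measure_biUnion_finset_le _ _).trans ?_)
  calc ∑ a ∈ Finset.range N ×ˢ Finset.range N, μ (Q a)
      ≤ ∑ a ∈ Finset.range N ×ˢ Finset.range N, K := by
        refine Finset.sum_le_sum fun a ha => ?_
        obtain ⟨h1, h2⟩ := Finset.mem_product.1 ha
        have e1 := haR _ h1
        have e2 := haR _ h2
        have p1 : 0 ≤ (a.1 : ℝ) * ℓ := by positivity
        have p2 : 0 ≤ (a.2 : ℝ) * ℓ := by positivity
        exact measure_exists_gt_square_le hB hw hd
          (hK _ _ (by linarith) (by linarith) (by linarith))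
    _ = ENNReal.ofReal ((N:ℝ) ^ 2) * K := by
        rw [Finset.sum_const, Finset.card_product, Finset.card_range, nsmul_eq_mul,
          ← pow_two, ← Nat.cast_pow N 2, ENNReal.ofReal_natCast]
    _ ≤ _ := by gcongr

end

/-- The mesh on which increments at level `(1 + η) u` have variance of order one. -/
noncomputable def meshWidth (H η u : ℝ) : ℝ := (√2 / ((1 + η) * u)) ^ (1 / H)

section

variable {H η u : ℝ}

lemma meshWidth_pos (hη : 0 < η) (hu : 0 < u) : 0 < meshWidth H η u := by
  unfold meshWidth; positivity

lemma sq_mul_meshWidth_rpow (hH : 0 < H) (hη : 0 < η) (hu : 0 < u) :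
    ((1 + η) * u) ^ 2 * meshWidth H η u ^ (2 * H) = 2 := by
  rw [meshWidth, ← rpow_mul (by positivity), show 1 / H * (2 * H) = (2:ℕ) by field_simp; norm_num,
    rpow_natCast, div_pow, sq_sqrt zero_le_two]
  field_simp

lemma meshWidth_eq (hη : 0 < η) (hu : 0 < u) :
    meshWidth H η u = √2 ^ (1 / H) * ((1 + η) * u) ^ (-(1 / H)) := by
  rw [meshWidth, div_rpow (sqrt_nonneg 2) (by positivity), rpow_neg (by positivity), div_eq_mul_inv]

lemma tendsto_one_add_mul_atTop (hη : 0 < η) : Tendsto (fun u : ℝ => (1 + η) * u) atTop atTop :=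
  tendsto_id.const_mul_atTop (by positivity)

lemma tendsto_meshWidth (hH : 0 < H) (hη : 0 < η) :
    Tendsto (meshWidth H η) atTop (nhds 0) := by
  have h := ((tendsto_rpow_neg_atTop (y := 1 / H) (by positivity)).comp
    (tendsto_one_add_mul_atTop hη)).const_mul (√2 ^ (1 / H))
  rw [mul_zero] at h
  refine h.congr' ?_
  filter_upwards [eventually_gt_atTop 0] with u hu
  exact (meshWidth_eq hη hu).symm

lemma tendsto_sq_mul_meshWidth (hH : H ∈ Ioo (0:ℝ) (1 / 2)) (hη : 0 < η) :
    Tendsto (fun u => ((1 + η) * u) ^ 2 * meshWidth H η u) atTop (nhds 0) := by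
  have h2 : 0 < 1 / H - 2 := by
    rw [sub_pos, lt_div_iff₀ hH.1]; linarith [hH.2]
  have h := ((tendsto_rpow_neg_atTop (y := 1 / H - 2) h2).comp
    (tendsto_one_add_mul_atTop hη)).const_mul (√2 ^ (1 / H))
  rw [mul_zero] at h
  refine h.congr' ?_
  filter_upwards [eventually_gt_atTop 0] with u hu
  have hg : 0 < (1 + η) * u := by positivity
  rw [meshWidth_eq hη hu, Function.comp, neg_sub, sub_eq_add_neg, rpow_add hg, rpow_ofNat]
  ring

end

namespace IsFBM

variable {Ω : Type*} [MeasurableSpace Ω] {μ : Measure Ω} {B : ℝ → Ω → ℝ} {H : ℝ}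

/-- Uniform bound for rectangles near the line `t - s = 1`, before optimizing the block length. -/
lemma eventually_measure_lt_supYOnRect_le [IsProbabilityMeasure μ] (hB : IsFBM B H μ)
    (hH : H ∈ Ioo (0:ℝ) (1 / 2)) {lam : ℝ} (hlam : 0 < lam)
    (hi : ∀ l ≥ lam, Integrable (fun ω => exp (⨆ t : Icc (0:ℝ) l,
      (√2 * B (t:ℝ) ω - (t:ℝ) ^ (2 * H)))) μ)
    {η : ℝ} (hη : 0 < η) {e : ℝ → ℝ} (he : Tendsto e atTop (nhds 0)) :
    ∀ᶠ u : ℝ in atTop, ∀ R t₂ s₁ : ℝ, 0 ≤ R → 0 ≤ s₁ → |t₂ - s₁ - 1| + 2 * R ≤ e u →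
      (μ {ω | u < supYOnRect B (t₂ - R) t₂ s₁ (s₁ + R) ω}).toReal ≤
      (R / (lam * meshWidth H η u) + 1) ^ 2 * (millsTerm (u / (t₂ - s₁) ^ H) *
        (((∫ ω, exp (⨆ t : Icc (0:ℝ) lam, (√2 * B (t:ℝ) ω - (t:ℝ) ^ (2 * H))) ∂μ) ^ 2 + η) *
          exp (2 * ((1 + η) ^ 2 - 1) * lam ^ (2 * H)))) := by
  obtain ⟨d, hd0, hd, hdd⟩ := exists_seq_subset_closure_range hlam.le
  obtain ⟨r, hr, hmain⟩ := hB.exists_measure_exists_gt_le hH hi hd0 hd hη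
  have hp0 : 0 < 2 * H := by linarith [hH.1]
  have hw := tendsto_meshWidth hH.1 hη
  have hlw : Tendsto (fun u => lam * meshWidth H η u) atTop (nhds 0) := by
    simpa using hw.const_mul lam
  have t2 : Tendsto (fun u => 1 - e u - 2 * (lam * meshWidth H η u)) atTop (nhds 1) := by
    simpa using (he.const_sub 1).sub (hlw.const_mul 2)
  have t3 : Tendsto (fun u => (1 + η) * ((1 - e u - lam * meshWidth H η u) ^ (2 * H) -
      (lam * meshWidth H η u) ^ (2 * H))) atTop (nhds (1 + η)) := by
    have h1 := ((he.const_sub 1).sub hlw).rpow_const (p := 2 * H) (Or.inr hp0.le)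
    have h2 := hlw.rpow_const (p := 2 * H) (Or.inr hp0.le)
    simpa [zero_rpow hp0.ne'] using (h1.sub h2).const_mul (1 + η)
  have t4 : Tendsto (fun u => (1 + e u) ^ (2 * H)) atTop (nhds 1) := by
    simpa using (he.const_add 1).rpow_const (p := 2 * H) (Or.inr hp0.le)
  have t5 : Tendsto (fun u => 2 * ((1 + η) * u) ^ 2 * (lam * meshWidth H η u)) atTop (nhds 0) := by
    have := (tendsto_sq_mul_meshWidth hH hη).const_mul (2 * lam)
    rw [mul_zero] at this
    exact this.congr fun u => by ring
  filter_upwards [eventually_gt_atTop 0, t2.eventually_const_le (u := 1 / 2) (by norm_num),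
    t3.eventually_const_le (u := 1) (by linarith), t4.eventually_le_const (u := 1 + η) (by linarith),
    t5.eventually_le_const hr] with u hu h2 h3 h4 h5 R t₂ s₁ hR hs₁ hR'
  set w := meshWidth H η u with hwdef
  have hw0 : 0 < w := meshWidth_pos hη hu
  have hlw0 : 0 < lam * w := by positivity
  have habs := abs_le.1 (by linarith : |t₂ - s₁ - 1| ≤ e u - 2 * R)
  set E : ℝ := ((∫ ω, exp (⨆ t : Icc (0:ℝ) lam, (√2 * B (t:ℝ) ω - (t:ℝ) ^ (2 * H))) ∂μ) ^ 2 + η) *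
          exp (2 * ((1 + η) ^ 2 - 1) * lam ^ (2 * H)) with hE
  have hE0 : 0 ≤ E := by positivity
  have hD2 : 0 < t₂ - s₁ := by linarith
  have hm0 : 0 < millsTerm (u / (t₂ - s₁) ^ H) :=
    millsTerm_pos (div_pos hu (rpow_pos_of_pos hD2 _))
  refine ENNReal.toReal_le_of_le_ofReal (by positivity) ?_
  rw [ENNReal.ofReal_mul (by positivity)]
  refine measure_lt_supYOnRect_le hB.continuous hlam hw0 hdd hR fun t₀ s₀ hs hD1 hD2' n => ?_
  have hD0 : 0 < t₀ - s₀ := by linarith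
  refine (hmain u w t₀ s₀ hu hw0 (sq_mul_meshWidth_rpow hH.1 hη hu) (by linarith) (by linarith) ?_
    h5 n).trans ?_
  · refine h3.trans ?_
    have hpow : (1 - e u - lam * w) ^ (2 * H) ≤ (t₀ - s₀ - lam * w) ^ (2 * H) :=
      rpow_le_rpow (by linarith) (by linarith) hp0.le
    exact mul_le_mul_of_nonneg_left (by linarith) (by positivity)
  · rw [← ENNReal.ofReal_mul (by positivity),
      ← ENNReal.ofReal_mul (millsTerm_pos (div_pos hu (rpow_pos_of_pos hD0 _))).le]
    refine ENNReal.ofReal_le_ofReal (mul_le_mul ?_ ?_ (by positivity) hm0.le)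
    · refine millsTerm_anti (div_pos hu (rpow_pos_of_pos hD2 _)) ?_
      gcongr
      exact hH.1.le
    · rw [hE]
      gcongr
      calc (1 + η) * (t₀ - s₀) ^ (2 * H) ≤ (1 + η) * (1 + e u) ^ (2 * H) := by
            gcongr; linarith
        _ ≤ (1 + η) ^ 2 := by rw [pow_two]; gcongr

end IsFBM

/-- Comparison of the Gaussian tail at levels `u / (1 - κ) ^ H` and `u / (1 - (H - ε) κ)`. -/
lemma millsTerm_div_rpow_le {H ε κ R u : ℝ} (hH : H ∈ Ioo (0:ℝ) (1 / 2)) (hε : ε ∈ Ioo 0 H)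
    (hu : 0 < u) (hR : 0 ≤ R) (hκ : -R ≤ κ) (hκ1 : κ < 1) :
    millsTerm (u / (1 - κ) ^ H) ≤ (1 + H * R) * exp (u ^ 2 * (H * R)) *
      ((1 + (1 + H * R) ^ 2 / u ^ 2) * stdNormalTail (u / (1 - (H - ε) * κ))) := by
  obtain ⟨hH0, hH2⟩ := hH
  obtain ⟨hε0, hεH⟩ := hε
  have hHR : 0 ≤ H * R := by positivity
  set q := 1 - (H - ε) * κ with hq
  set q' := 1 - H * κ with hq'
  have hq0 : 0 < q := by nlinarith
  have hq'0 : 0 < q' := by nlinarith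
  have hqR : q ≤ 1 + H * R := by nlinarith
  have hq'R : q' ≤ 1 + H * R := by nlinarith
  have h1 : millsTerm (u / (1 - κ) ^ H) ≤ millsTerm (u / q') := by
    refine millsTerm_anti (by positivity) ?_
    have hb : (1 - κ) ^ H ≤ q' := by
      have := rpow_one_add_le_one_add_mul_self (s := -κ) (p := H) (by linarith) hH0.le (by linarith)
      rw [← sub_eq_add_neg] at this
      linarith
    have : 0 < (1 - κ) ^ H := rpow_pos_of_pos (by linarith) _
    gcongr
  have h2 : millsTerm (u / q') ≤ (1 + H * R) * exp (u ^ 2 * (H * R)) * millsTerm (u / q) := by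
    have hm := millsTerm_pos (div_pos hu hq0)
    rcases le_or_gt 0 κ with h | h
    · have h3 : millsTerm (u / q') ≤ millsTerm (u / q) := by
        refine millsTerm_anti (by positivity) ?_
        gcongr
        nlinarith
      have h4 : 1 ≤ exp (u ^ 2 * (H * R)) := one_le_exp (by positivity)
      have h5 : 1 ≤ (1 + H * R) * exp (u ^ 2 * (H * R)) := by nlinarith
      nlinarith
    · have hq1 : 1 ≤ q := by nlinarith
      have hexp : exp (-(u / q') ^ 2 / 2) ≤ exp (u ^ 2 * (H * R)) * exp (-(u / q) ^ 2 / 2) := by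
        rw [← exp_add, exp_le_exp]
        have e1 : (u / q) ^ 2 ≤ u ^ 2 := by
          rw [div_pow]; exact div_le_self (by positivity) (one_le_pow₀ hq1)
        have e2 : u ^ 2 * (1 - 2 * (H * R)) ≤ (u / q') ^ 2 := by
          rw [div_pow, le_div_iff₀ (by positivity), mul_assoc]
          refine mul_le_of_le_one_right (by positivity) ?_
          have hq'2 : q' ^ 2 ≤ (1 + H * R) ^ 2 := by gcongr
          rcases le_or_gt (1 - 2 * (H * R)) 0 with hx | hx
          · nlinarith [sq_nonneg q']
          · nlinarith [mul_nonneg hHR (sq_nonneg (H * R)), sq_nonneg (H * R)]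
        linarith
      unfold millsTerm
      have hs : 0 < √(2 * π) := by positivity
      calc exp (-(u / q') ^ 2 / 2) / (u / q' * √(2 * π))
          = q' * exp (-(u / q') ^ 2 / 2) / (u * √(2 * π)) := by field_simp
        _ ≤ (1 + H * R) * (exp (u ^ 2 * (H * R)) * exp (-(u / q) ^ 2 / 2)) /
            (u / q * √(2 * π)) := by
            gcongr
            exact div_le_self hu.le hq1
        _ = _ := by ring
  refine h1.trans (h2.trans ?_)
  gcongr
  refine (millsTerm_le_stdNormalTail (by positivity)).trans ?_
  have hΨ : 0 ≤ stdNormalTail (u / q) := ENNReal.toReal_nonneg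
  have hy : 1 / (u / q) ^ 2 ≤ (1 + H * R) ^ 2 / u ^ 2 := by
    rw [div_pow, one_div_div]
    gcongr
  exact mul_le_mul_of_nonneg_right (by linarith) hΨ

lemma inv_meshWidth_sq {H η u : ℝ} (hη : 0 < η) (hu : 0 < u) :
    (meshWidth H η u)⁻¹ ^ 2 = (1 / 2) ^ (1 / H) * (1 + η) ^ (2 / H) * u ^ (2 / H) := by
  have e : ∀ x : ℝ, 0 ≤ x → x ^ (2 / H) = (x ^ 2) ^ (1 / H) := fun x hx => by
    rw [← rpow_natCast x 2, ← rpow_mul hx]; congr 1; push_cast; ring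
  have e' : ∀ x : ℝ, 0 ≤ x → (x ^ (1 / H)) ^ 2 = (x ^ 2) ^ (1 / H) := fun x hx => by
    rw [← rpow_natCast, ← rpow_natCast, ← rpow_mul hx, ← rpow_mul hx, mul_comm]
  rw [meshWidth, ← inv_rpow (by positivity), inv_div, e' _ (by positivity), e _ (by positivity),
    e _ hu.le, ← mul_rpow (by positivity) (by positivity), ← mul_rpow (by positivity) (by positivity), div_pow,
    sq_sqrt zero_le_two]
  congr 1; ring

lemma tendsto_log_sq_div_sq : Tendsto (fun u : ℝ => log u ^ 2 / u ^ 2) atTop (nhds 0) := by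
  have h := isLittleO_log_id_atTop.tendsto_div_nhds_zero.pow 2
  rw [zero_pow two_ne_zero] at h
  exact h.congr fun u => by rw [id, div_pow]

/-- The ratio between the block bound and the claimed asymptotic expression. -/
noncomputable def rectangleFactor (H H' lam η E u : ℝ) : ℝ :=
  E * ((lam⁻¹) ^ 2 * ((1 / 2) ^ (1 / H) * (1 + η) ^ (2 / H))) *
    ((1 + lam * (meshWidth H η u / u ^ (-(2:ℝ) / H'))) ^ 2 *
      (1 + H * u ^ (-(2:ℝ) / H')) ^ (2 / H) *
      ((1 + H * u ^ (-(2:ℝ) / H')) * exp (H * (u ^ 2 * u ^ (-(2:ℝ) / H'))) *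
        (1 + (1 + H * u ^ (-(2:ℝ) / H')) ^ 2 / u ^ 2)))

lemma tendsto_rectangleFactor {H H' lam η E : ℝ} (hH : 0 < H) (hH' : H' ∈ Ioo (2 * H) 1)
    (hη : 0 < η) : Tendsto (rectangleFactor H H' lam η E) atTop
      (nhds (E * ((lam⁻¹) ^ 2 * ((1 / 2) ^ (1 / H) * (1 + η) ^ (2 / H))))) := by
  have hH'0 : 0 < H' := by linarith [hH'.1]
  have hR : Tendsto (fun u : ℝ => u ^ (-(2:ℝ) / H')) atTop (nhds 0) := by
    have := tendsto_rpow_neg_atTop (y := 2 / H') (by positivity)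
    simpa only [neg_div] using this
  have hu2 : Tendsto (fun u : ℝ => u ^ 2 * u ^ (-(2:ℝ) / H')) atTop (nhds 0) := by
    have h2 : 0 < 2 / H' - 2 := by
      rw [sub_pos, lt_div_iff₀ hH'0]; linarith [hH'.2]
    refine (tendsto_rpow_neg_atTop h2).congr' ?_
    filter_upwards [eventually_gt_atTop 0] with u hu
    rw [← rpow_two, ← rpow_add hu]
    congr 1; ring
  have hw : Tendsto (fun u : ℝ => meshWidth H η u / u ^ (-(2:ℝ) / H')) atTop (nhds 0) := by
    have h2 : 0 < 1 / H - 2 / H' := by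
      rw [sub_pos, div_lt_div_iff₀ hH'0 hH]; linarith [hH'.1]
    have h := (tendsto_rpow_neg_atTop h2).const_mul (√2 ^ (1 / H) * (1 + η) ^ (-(1 / H)))
    rw [mul_zero] at h
    refine h.congr' ?_
    filter_upwards [eventually_gt_atTop 0] with u hu
    rw [meshWidth_eq hη hu, mul_rpow (by positivity) hu.le, ← mul_assoc, mul_div_assoc,
      ← rpow_sub hu]
    congr 2; ring
  have hinv : Tendsto (fun u : ℝ => (u ^ 2)⁻¹) atTop (nhds 0) :=
    tendsto_inv_atTop_zero.comp (tendsto_pow_atTop two_ne_zero)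
  have h1 : Tendsto (fun u : ℝ => 1 + H * u ^ (-(2:ℝ) / H')) atTop (nhds 1) := by
    simpa using (hR.const_mul H).const_add 1
  have h2 : Tendsto (fun u : ℝ => (1 + lam * (meshWidth H η u / u ^ (-(2:ℝ) / H'))) ^ 2) atTop
      (nhds 1) := by
    simpa using ((hw.const_mul lam).const_add 1).pow 2
  have h3 : Tendsto (fun u : ℝ => (1 + H * u ^ (-(2:ℝ) / H')) ^ (2 / H)) atTop (nhds 1) := by
    simpa using h1.rpow_const (p := 2 / H) (Or.inl one_ne_zero)
  have h4 : Tendsto (fun u : ℝ => exp (H * (u ^ 2 * u ^ (-(2:ℝ) / H')))) atTop (nhds 1) := by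
    simpa using (hu2.const_mul H).rexp
  have h5 : Tendsto (fun u : ℝ => 1 + (1 + H * u ^ (-(2:ℝ) / H')) ^ 2 / u ^ 2) atTop (nhds 1) := by
    simpa [div_eq_mul_inv] using ((h1.pow 2).mul hinv).const_add 1
  have h := ((h2.mul h3).mul ((h1.mul h4).mul h5)).const_mul
    (E * ((lam⁻¹) ^ 2 * ((1 / 2) ^ (1 / H) * (1 + η) ^ (2 / H))))
  simp only [mul_one] at h
  exact h

lemma block_bound_le_rectangleFactor {H H' ε lam η E κ u : ℝ} (hH : H ∈ Ioo (0:ℝ) (1 / 2))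
    (hε : ε ∈ Ioo 0 H) (hlam : 0 < lam) (hη : 0 < η) (hE : 0 ≤ E) (hu : 0 < u)
    (hκ : -u ^ (-(2:ℝ) / H') ≤ κ) (hκ1 : κ < 1) :
    (u ^ (-(2:ℝ) / H') / (lam * meshWidth H η u) + 1) ^ 2 *
        (millsTerm (u / (1 - κ) ^ H) * E) ≤
      rectangleFactor H H' lam η E u * ((u / (1 - (H - ε) * κ)) ^ (2 / H) *
        (u ^ (-(2:ℝ) / H')) ^ 2 * stdNormalTail (u / (1 - (H - ε) * κ))) := by
  unfold rectangleFactor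
  set R := u ^ (-(2:ℝ) / H') with hR
  have hR0 : 0 < R := rpow_pos_of_pos hu _
  have hH0 := hH.1
  have hw : 0 < meshWidth H η u := meshWidth_pos hη hu
  have hm := millsTerm_div_rpow_le hH hε hu hR0.le hκ hκ1
  set q := 1 - (H - ε) * κ with hq
  have hq0 : 0 < q := by nlinarith [hε.1, hε.2, hH.2]
  have hqR : q ≤ 1 + H * R := by nlinarith [hε.1, hε.2]
  have hΨ : 0 ≤ stdNormalTail (u / q) := ENNReal.toReal_nonneg
  have e1 : (R / (lam * meshWidth H η u) + 1) ^ 2 =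
      (1 + lam * (meshWidth H η u / R)) ^ 2 * R ^ 2 * (lam⁻¹) ^ 2 * (meshWidth H η u)⁻¹ ^ 2 := by
    field_simp
  have hm0 : 0 ≤ millsTerm (u / (1 - κ) ^ H) :=
    (millsTerm_pos (div_pos hu (rpow_pos_of_pos (by linarith) _))).le
  have e2 : u ^ (2 / H) ≤ (u / q) ^ (2 / H) * (1 + H * R) ^ (2 / H) := by
    calc u ^ (2 / H) = (u / q) ^ (2 / H) * q ^ (2 / H) := by
          rw [← mul_rpow (by positivity) hq0.le, div_mul_cancel₀ _ hq0.ne']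
      _ ≤ _ := by gcongr
  rw [e1, inv_meshWidth_sq hη hu]
  calc _ ≤ (1 + lam * (meshWidth H η u / R)) ^ 2 * R ^ 2 * (lam⁻¹) ^ 2 *
        ((1 / 2) ^ (1 / H) * (1 + η) ^ (2 / H) * ((u / q) ^ (2 / H) * (1 + H * R) ^ (2 / H))) *
        ((1 + H * R) * exp (u ^ 2 * (H * R)) *
      ((1 + (1 + H * R) ^ 2 / u ^ 2) * stdNormalTail (u / q)) * E) := by gcongr
    _ = _ := by rw [show u ^ 2 * (H * R) = H * (u ^ 2 * R) by ring]; ring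

lemma exists_block_length {H HH ε : ℝ} (hH : 0 < H) (hε : 0 < ε) (hHH : 0 < HH) {P : ℝ → ℝ}
    (hP : Tendsto (fun lam : ℝ => lam⁻¹ * P lam) atTop (nhds HH)) :
    ∃ lam > 0, (∀ l ≥ lam, P l ≠ 0) ∧ ∃ η > 0,
      ((P lam) ^ 2 + η) * exp (2 * ((1 + η) ^ 2 - 1) * lam ^ (2 * H)) *
        ((lam⁻¹) ^ 2 * ((1 / 2) ^ (1 / H) * (1 + η) ^ (2 / H))) < (1 / 2 + ε) ^ (1 / H) * HH ^ 2 := by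
  have h1 : (1 / 2 : ℝ) ^ (1 / H) * HH ^ 2 < (1 / 2 + ε) ^ (1 / H) * HH ^ 2 := by
    have : (1 / 2 : ℝ) ^ (1 / H) < (1 / 2 + ε) ^ (1 / H) :=
      rpow_lt_rpow (by norm_num) (by linarith) (by positivity)
    gcongr
  have h2 := ((hP.pow 2).const_mul ((1 / 2 : ℝ) ^ (1 / H))).eventually_lt_const h1
  obtain ⟨l₀, hl₀⟩ := eventually_atTop.1 (hP.eventually_const_lt hHH)
  obtain ⟨lam, h3, h4, h5⟩ := (h2.and ((eventually_gt_atTop 0).and (eventually_ge_atTop l₀))).exists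
  refine ⟨lam, h4, fun l hl h0 => ?_, ?_⟩
  · have := hl₀ l (h5.trans hl)
    simp [h0] at this
  · have hc : ContinuousAt (fun η : ℝ => ((P lam) ^ 2 + η) *
        exp (2 * ((1 + η) ^ 2 - 1) * lam ^ (2 * H)) *
        ((lam⁻¹) ^ 2 * ((1 / 2) ^ (1 / H) * (1 + η) ^ (2 / H)))) 0 := by
      have : ContinuousAt (fun η : ℝ => (1 + η) ^ (2 / H)) 0 :=
        (by fun_prop : ContinuousAt (fun η : ℝ => 1 + η) 0).rpow_const (Or.inl (by norm_num))
      fun_prop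
    have h6 := (hc.tendsto.mono_left (nhdsWithin_le_nhds (s := Ioi 0))).eventually_lt_const
      (u := (1 / 2 + ε) ^ (1 / H) * HH ^ 2) (by
        simp only [add_zero, one_pow, sub_self, mul_zero, zero_mul, exp_zero, one_rpow, mul_one]
        rw [mul_pow] at h3
        linarith)
    obtain ⟨η, h7, h8⟩ := (h6.and self_mem_nhdsWithin).exists
    exact ⟨η, h8, h7⟩

/-- Upper bound (3.2): with `R_u = u^{-2/H'}`, `δ_u = (ln u)²/u²`, for the rectangles
`J_{k,l} = [1+(l-k)R_u, 1+(l-k+1)R_u] × [(l-1)R_u, lR_u]` and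
`u_{k-} = u/(1-(H-ε)(k-2)R_u)`, for all large `u`:
`P(max_{J_{k,l}} Y_H > u) ≤ (1/2+ε)^{1/H} 𝓗_{2H}² u_{k-}^{2/H} R_u² Ψ(u_{k-})`. -/
theorem shepp_fbm_rectangle_upper_bound
    {Ω : Type*} [MeasurableSpace Ω] (μ : Measure Ω) [IsProbabilityMeasure μ]
    (H : ℝ) (hH : H ∈ Set.Ioo (0:ℝ) (1/2))
    (B : ℝ → Ω → ℝ)
    (hmeas : ∀ t : ℝ, Measurable (B t))
    (hzero : ∀ ω, B 0 ω = 0)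
    (hcont : ∀ᵐ ω ∂μ, Continuous fun t => B t ω)
    (hgauss : ∀ (n : ℕ) (c : Fin n → ℝ) (t : Fin n → ℝ),
      ∃ v : NNReal, μ.map (fun ω => ∑ i, c i * B (t i) ω) =
        ProbabilityTheory.gaussianReal 0 v)
    (hcov : ∀ t s : ℝ, 0 ≤ t → 0 ≤ s →
      ∫ ω, B t ω * B s ω ∂μ = (t ^ (2*H) + s ^ (2*H) - |t - s| ^ (2*H)) / 2)
    (HH : ℝ) (hHH : 0 < HH)
    (hPick : Tendsto (fun lam : ℝ => lam⁻¹ *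
        ∫ ω, Real.exp (⨆ t : Set.Icc (0:ℝ) lam,
          (Real.sqrt 2 * B (t:ℝ) ω - (t:ℝ) ^ (2*H))) ∂μ) atTop (nhds HH))
    (ε : ℝ) (hε : ε ∈ Set.Ioo (0:ℝ) H)
    (H' : ℝ) (hH' : H' ∈ Set.Ioo (2*H) 1) (T : ℝ) (hT : 0 < T) :
    ∀ᶠ u : ℝ in atTop, ∀ k l : ℤ,
      1 ≤ l → (l : ℝ) ≤ T / u ^ (-(2:ℝ)/H') →
      1 ≤ k → (k : ℝ) ≤ ((Real.log u)^2 / u^2) / u ^ (-(2:ℝ)/H') + 1 →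
      (μ {ω | u < supYOnRect B
            (1 + ((l : ℝ) - (k : ℝ)) * u ^ (-(2:ℝ)/H'))
            (1 + ((l : ℝ) - (k : ℝ) + 1) * u ^ (-(2:ℝ)/H'))
            (((l : ℝ) - 1) * u ^ (-(2:ℝ)/H'))
            ((l : ℝ) * u ^ (-(2:ℝ)/H')) ω}).toReal ≤
        (1/2 + ε) ^ (1/H) * HH ^ 2 *
          (u / (1 - (H - ε) * ((k : ℝ) - 2) * u ^ (-(2:ℝ)/H'))) ^ (2/H) *
          (u ^ (-(2:ℝ)/H'))^2 *
          stdNormalTail (u / (1 - (H - ε) * ((k : ℝ) - 2) * u ^ (-(2:ℝ)/H'))) := by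
  have hB : IsFBM B H μ := ⟨hmeas, hzero, hcont, hgauss, hcov⟩
  obtain ⟨lam, hlam, hne, η, hη, hlt⟩ := exists_block_length hH.1 hε.1 hHH hPick
  have hi : ∀ l ≥ lam, Integrable (fun ω => exp (⨆ t : Icc (0:ℝ) l,
      (√2 * B (t:ℝ) ω - (t:ℝ) ^ (2 * H)))) μ := fun l hl =>
    not_imp_comm.1 integral_undef (hne l hl)
  have hH'0 : 0 < H' := by linarith [hH'.1, hH.1]
  have hR : Tendsto (fun u : ℝ => u ^ (-(2:ℝ) / H')) atTop (nhds 0) := by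
    have := tendsto_rpow_neg_atTop (y := 2 / H') (by positivity)
    simpa only [neg_div] using this
  have he : Tendsto (fun u : ℝ => log u ^ 2 / u ^ 2 + 3 * u ^ (-(2:ℝ) / H')) atTop (nhds 0) := by
    simpa using tendsto_log_sq_div_sq.add (hR.const_mul 3)
  filter_upwards [eventually_gt_atTop 0, he.eventually_lt_const one_pos,
    hB.eventually_measure_lt_supYOnRect_le hH hlam hi hη he,
    (tendsto_rectangleFactor hH.1 hH' hη).eventually_lt_const hlt] with u hu he1 hmain hfac k l hl _ hk hk'
  set R := u ^ (-(2:ℝ) / H') with hRdef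
  have hR0 : 0 < R := rpow_pos_of_pos hu _
  have hl1 : (1:ℝ) ≤ l := by exact_mod_cast hl
  have hk1 : (1:ℝ) ≤ k := by exact_mod_cast hk
  have hkR : (k:ℝ) * R ≤ log u ^ 2 / u ^ 2 + R := by
    calc (k:ℝ) * R ≤ (log u ^ 2 / u ^ 2 / R + 1) * R := by gcongr
      _ = _ := by field_simp
  have hkR' : R ≤ k * R := le_mul_of_one_le_left hR0.le hk1
  have hδ : 0 ≤ log u ^ 2 / u ^ 2 := by positivity
  have hκ : ((1 + ((l : ℝ) - k + 1) * R) - ((l : ℝ) - 1) * R) = 1 - ((k:ℝ) - 2) * R := by ring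
  have h1 := hmain R (1 + ((l : ℝ) - k + 1) * R) (((l : ℝ) - 1) * R) hR0.le
    (mul_nonneg (by linarith) hR0.le) (by
      have : |(1 + ((l : ℝ) - k + 1) * R) - ((l : ℝ) - 1) * R - 1| ≤ log u ^ 2 / u ^ 2 + R := by
        rw [hκ, abs_le]
        constructor <;> linarith
      linarith)
  rw [hκ, show 1 + ((l : ℝ) - k + 1) * R - R = 1 + ((l : ℝ) - k) * R by ring,
    show ((l : ℝ) - 1) * R + R = l * R by ring] at h1
  have h2 := h1.trans (block_bound_le_rectangleFactor (H' := H') hH hε hlam hη (by positivity) hu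
    (by linarith) (by linarith))
  rw [← mul_assoc (H - ε)] at h2
  have hq : 0 ≤ 1 - (H - ε) * ((k:ℝ) - 2) * R := by nlinarith [hε.1, hε.2, hH.2]
  have hΨ (x : ℝ) : 0 ≤ stdNormalTail x := ENNReal.toReal_nonneg
  refine h2.trans ((mul_le_mul_of_nonneg_right hfac.le (mul_nonneg (mul_nonneg
    (rpow_nonneg (div_nonneg hu.le hq) _) (sq_nonneg R)) (hΨ _))).trans_eq ?_)
  ring
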